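/- (Main Theorem, Shannon entropy) Let f_1,…,f_k be probability densities on R^n. If the differential entropies h(f_1 ⋆ ⋯ ⋆ f_k) and h(f_1* ⋆ ⋯ ⋆ f_k*) are both well defined, then h(f_1 ⋆ ⋯ ⋆ f_k) ≥ h(f_1* ⋆ ⋯ ⋆ f_k*). In random-variable notation: h(X_1 + ⋯ + X_k) ≥ h(X_1* + ⋯ + X_k*) for independent X_i with densities f_i and independent X_i* with densities f_i*. -/

import Mathlib

open MeasureTheory Set Filter ENNReal

noncomputable section

/-- The spherically symmetric (decreasing) rearrangement of a set `A ⊆ ℝⁿ`: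
the centered open ball with the same Lebesgue measure as `A`
(empty if `A` is null, all of `ℝⁿ` if `A` has infinite measure). -/
def ballRearrange (n : ℕ) (A : Set (EuclideanSpace ℝ (Fin n))) :
    Set (EuclideanSpace ℝ (Fin n)) :=
  {x | volume (Metric.ball (0 : EuclideanSpace ℝ (Fin n)) ‖x‖) < volume A}

/-- The spherically symmetric decreasing rearrangement of a function:
`f*(y) = ∫₀^∞ 1{y ∈ {x : f x > t}*} dt`. -/
def symmRearr (n : ℕ) (f : EuclideanSpace ℝ (Fin n) → ℝ≥0∞) :
    EuclideanSpace ℝ (Fin n) → ℝ≥0∞ :=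
  fun y => ∫⁻ t in Ioi (0 : ℝ), (ballRearrange n {x | ENNReal.ofReal t < f x}).indicator 1 y

/-- `f` is a probability density on `ℝⁿ`. -/
def IsDensity (n : ℕ) (f : EuclideanSpace ℝ (Fin n) → ℝ≥0∞) : Prop :=
  Measurable f ∧ ∫⁻ x, f x = 1

/-- Integral of the positive part of `-f log f`. -/
def entPos (n : ℕ) (f : EuclideanSpace ℝ (Fin n) → ℝ≥0∞) : ℝ≥0∞ :=
  ∫⁻ x, ENNReal.ofReal (-((f x).toReal * Real.log (f x).toReal))

/-- Integral of the negative part of `-f log f`. -/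
def entNeg (n : ℕ) (f : EuclideanSpace ℝ (Fin n) → ℝ≥0∞) : ℝ≥0∞ :=
  ∫⁻ x, ENNReal.ofReal ((f x).toReal * Real.log (f x).toReal)

/-- The Shannon differential entropy `h(f) = -∫ f log f` is well defined. -/
def EntDefined (n : ℕ) (f : EuclideanSpace ℝ (Fin n) → ℝ≥0∞) : Prop :=
  entPos n f ≠ ⊤ ∨ entNeg n f ≠ ⊤

/-- The Shannon differential entropy as an extended real number. -/
def entropy (n : ℕ) (f : EuclideanSpace ℝ (Fin n) → ℝ≥0∞) : EReal :=
  (entPos n f : EReal) - (entNeg n f : EReal)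

/-- The Rényi entropy of order `p ∈ (0,1) ∪ (1,∞)`:
`h_p(f) = (1/(1-p)) log ∫ f^p`. -/
def renyi (n : ℕ) (f : EuclideanSpace ℝ (Fin n) → ℝ≥0∞) (p : ℝ) : EReal :=
  (((1 - p)⁻¹ : ℝ) : EReal) * ENNReal.log (∫⁻ x, f x ^ p)

/-- Convolution of two `ℝ≥0∞`-valued functions on `ℝⁿ`. -/
def conv2 (n : ℕ) (f g : EuclideanSpace ℝ (Fin n) → ℝ≥0∞) :
    EuclideanSpace ℝ (Fin n) → ℝ≥0∞ :=
  fun x => ∫⁻ y, f y * g (x - y)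

/-- Iterated convolution of a (nonempty) list of functions. -/
def convList (n : ℕ) : List (EuclideanSpace ℝ (Fin n) → ℝ≥0∞) →
    (EuclideanSpace ℝ (Fin n) → ℝ≥0∞)
  | [] => fun _ => 0
  | [f] => f
  | f :: g :: rest => conv2 n f (convList n (g :: rest))

/-- `f ≺ g`: `f` is majorized by `g`. -/
def Majorizes (n : ℕ) (f g : EuclideanSpace ℝ (Fin n) → ℝ≥0∞) : Prop :=
  ∀ r : ℝ, 0 < r →
    ∫⁻ x in Metric.ball (0 : EuclideanSpace ℝ (Fin n)) r, symmRearr n f x ≤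
      ∫⁻ x in Metric.ball (0 : EuclideanSpace ℝ (Fin n)) r, symmRearr n g x

/-- The measure of `{(x, y) ∈ A × B : x + y ∈ C}`. -/
def rieszSet {G : Type*} [AddGroup G] [MeasureSpace G] (A B C : Set G) : ℝ≥0∞ :=
  ((volume : Measure G).prod volume) {p : G × G | p.1 ∈ A ∧ p.2 ∈ B ∧ p.1 + p.2 ∈ C}

section Group

variable {G : Type*} [AddCommGroup G] [MeasureSpace G] {A B C : Set G}

theorem rieszSet_mono {A' B' C' : Set G} (hA : A ⊆ A') (hB : B ⊆ B') (hC : C ⊆ C') :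
    rieszSet A B C ≤ rieszSet A' B' C' :=
  measure_mono fun _ hp => ⟨hA hp.1, hB hp.2.1, hC hp.2.2⟩

theorem rieszSet_le_mul [SFinite (volume : Measure G)] :
    rieszSet A B C ≤ volume A * volume B := by
  rw [rieszSet, ← Measure.prod_prod]
  exact measure_mono fun p hp => ⟨hp.1, hp.2.1⟩

variable [MeasurableAdd₂ G]

theorem measurableSet_rieszSet (hA : MeasurableSet A) (hB : MeasurableSet B)
    (hC : MeasurableSet C) :
    MeasurableSet {p : G × G | p.1 ∈ A ∧ p.2 ∈ B ∧ p.1 + p.2 ∈ C} :=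
  (measurable_fst hA).inter ((measurable_snd hB).inter (measurable_add hC))

variable [SFinite (volume : Measure G)]

theorem rieszSet_comm (hA : MeasurableSet A) (hB : MeasurableSet B) (hC : MeasurableSet C) :
    rieszSet A B C = rieszSet B A C := by
  have h := (Measure.measurePreserving_swap (μ := (volume : Measure G))
    (ν := (volume : Measure G))).measure_preimage
      (measurableSet_rieszSet hA hB hC).nullMeasurableSet
  rw [rieszSet, rieszSet, ← h]
  congr 1
  ext p
  simp only [mem_preimage, mem_ofPred_eq, Prod.fst_swap, Prod.snd_swap, add_comm p.2 p.1]
  tauto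

variable [(volume : Measure G).IsAddLeftInvariant]

theorem rieszSet_le_mul_left (hA : MeasurableSet A) (hB : MeasurableSet B)
    (hC : MeasurableSet C) : rieszSet A B C ≤ volume A * volume C := by
  rw [rieszSet, Measure.prod_apply (measurableSet_rieszSet hA hB hC)]
  calc _ ≤ ∫⁻ x, A.indicator (fun _ => volume C) x := by
        refine lintegral_mono fun x => ?_
        by_cases hx : x ∈ A
        · rw [indicator_of_mem hx, ← measure_preimage_add volume x C]
          exact measure_mono fun y hy => hy.2.2
        · simp [hx]
    _ = _ := by rw [lintegral_indicator_const hA, mul_comm]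

theorem rieszSet_le_mul_right (hA : MeasurableSet A) (hB : MeasurableSet B)
    (hC : MeasurableSet C) : rieszSet A B C ≤ volume B * volume C := by
  rw [rieszSet_comm hA hB hC]
  exact rieszSet_le_mul_left hB hA hC

variable [MeasurableNeg G]

theorem prod_apply_sub {S : Set (G × G)} (hS : MeasurableSet S) :
    ((volume : Measure G).prod volume) S = ∫⁻ z : G, volume {x : G | (x, z - x) ∈ S} := by
  have hm : Measurable fun p : G × G => (p.1, p.2 - p.1) :=
    measurable_fst.prodMk (measurable_snd.sub measurable_fst)
  have hT : MeasurableSet {p : G × G | (p.1, p.2 - p.1) ∈ S} := hm hS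
  have h1 : ((volume : Measure G).prod volume) {p : G × G | (p.1, p.2 - p.1) ∈ S} =
      ∫⁻ z : G, volume {x : G | (x, z - x) ∈ S} := by
    rw [Measure.prod_apply_symm hT]
    rfl
  rw [← h1, Measure.prod_apply hS, Measure.prod_apply hT]
  refine lintegral_congr fun x => ?_
  rw [← measure_preimage_add volume (-x) (Prod.mk x ⁻¹' S)]
  congr 1
  ext z
  simp [sub_eq_neg_add]

end Group

theorem lipschitz_volume_inter_Iic {A : Set ℝ} (hA : volume A ≠ ⊤) :
    LipschitzWith 1 fun x => volume.real (A ∩ Iic x) := by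
  have key : ∀ x y : ℝ, x ≤ y →
      volume.real (A ∩ Iic y) ≤ volume.real (A ∩ Iic x) + (y - x) := by
    intro x y hxy
    have hfin : volume (A ∩ Iic x) ≠ ⊤ := measure_ne_top_of_subset inter_subset_left hA
    have h1 : A ∩ Iic y ⊆ (A ∩ Iic x) ∪ Ioc x y := by
      rintro z ⟨hz, hzy⟩
      rcases le_or_gt z x with h | h
      · exact Or.inl ⟨hz, h⟩
      · exact Or.inr ⟨h, hzy⟩
    calc _ ≤ volume.real ((A ∩ Iic x) ∪ Ioc x y) :=
          measureReal_mono h1 (measure_union_ne_top hfin (by simp))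
      _ ≤ volume.real (A ∩ Iic x) + volume.real (Ioc x y) := measureReal_union_le _ _
      _ = _ := by rw [Real.volume_real_Ioc_of_le hxy]
  refine LipschitzWith.of_le_add_mul 1 fun x y => ?_
  rw [NNReal.coe_one, one_mul, Real.dist_eq]
  rcases le_total y x with h | h
  · rw [abs_of_nonneg (sub_nonneg.2 h)]
    exact key y x h
  · have : volume.real (A ∩ Iic x) ≤ volume.real (A ∩ Iic y) :=
      measureReal_mono (inter_subset_inter_right _ (Iic_subset_Iic.2 h))
        (measure_ne_top_of_subset inter_subset_left hA)
    linarith [abs_nonneg (x - y)]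

theorem exists_volume_inter_Iic_eq {A : Set ℝ} (hA : volume A ≠ ⊤) {t : ℝ}
    (h0 : 0 < t) (ht : t < volume.real A) : ∃ x, volume.real (A ∩ Iic x) = t := by
  have : IsFiniteMeasure (volume.restrict A) := ⟨by simpa using hA.lt_top⟩
  have hr : ∀ x, volume.real (A ∩ Iic x) = (volume.restrict A).real (Iic x) := fun x => by
    rw [measureReal_restrict_apply measurableSet_Iic, inter_comm]
  have hT : Tendsto (fun x => volume.real (A ∩ Iic x)) atTop (nhds (volume.real A)) := by
    simp_rw [hr]
    have := (ENNReal.tendsto_toReal (measure_ne_top _ _)).comp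
      (tendsto_measure_Iic_atTop (volume.restrict A))
    simpa [Measure.real, Function.comp_def] using this
  have hB : Tendsto (fun x : ℝ => volume.real (A ∩ Iic x)) atBot (nhds 0) := by
    simp_rw [hr]
    have h := tendsto_measure_iInter_atBot (μ := volume.restrict A) (s := fun x : ℝ => Iic x)
      (fun _ => measurableSet_Iic.nullMeasurableSet) (fun x y h => Iic_subset_Iic.2 h)
      ⟨0, measure_ne_top _ _⟩
    have he : (⋂ x : ℝ, Iic x) = ∅ := by
      ext z
      simp only [mem_iInter, mem_Iic, mem_empty_iff_false, iff_false, not_forall, not_le]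
      exact exists_lt z
    rw [he, measure_empty] at h
    simpa [Measure.real, Function.comp_def] using
      (ENNReal.tendsto_toReal ENNReal.zero_ne_top).comp h
  obtain ⟨x, hx⟩ := ((hB.eventually (gt_mem_nhds h0)).exists)
  obtain ⟨y, hy⟩ := ((hT.eventually (lt_mem_nhds ht)).exists)
  exact mem_range_of_exists_le_of_exists_ge (lipschitz_volume_inter_Iic hA).continuous
    ⟨x, hx.le⟩ ⟨y, hy.le⟩

theorem exists_volume_inter_Ici_eq {A : Set ℝ} (hA : volume A ≠ ⊤) {t : ℝ}
    (h0 : 0 < t) (ht : t < volume.real A) : ∃ x, volume.real (A ∩ Ici x) = t := by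
  have hn : volume (-A) = volume A := Measure.measure_neg volume A
  obtain ⟨x, hx⟩ := exists_volume_inter_Iic_eq (A := -A) (by rwa [hn]) h0
    (by rwa [Measure.real, hn])
  refine ⟨-x, ?_⟩
  have : A ∩ Ici (-x) = -(-A ∩ Iic x) := by
    ext z; simp
  rw [← hx, Measure.real, this, Measure.measure_neg, Measure.real]

theorem rieszSet_real_le {A B C : Set ℝ} (hA : MeasurableSet A) (hB : MeasurableSet B)
    (hC : MeasurableSet C) (hA' : volume A ≠ ⊤) (hB' : volume B ≠ ⊤) (hC' : volume C ≠ ⊤) {t : ℝ}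
    (h0 : 0 < t) (hta : t < volume.real A) (htb : t < volume.real B) :
    rieszSet A B C ≤ ENNReal.ofReal
      ((volume.real A - t) * (volume.real B - t) + t * volume.real C) := by
  obtain ⟨a, ha⟩ := exists_volume_inter_Iic_eq hA' h0 hta
  obtain ⟨b, hb⟩ := exists_volume_inter_Ici_eq hB' h0 htb
  have haf : volume (A ∩ Iic a) ≠ ⊤ := measure_ne_top_of_subset inter_subset_left hA'
  have hbf : volume (B ∩ Ici b) ≠ ⊤ := measure_ne_top_of_subset inter_subset_left hB'
  have ha1 : volume (A ∩ Iic a) = ENNReal.ofReal t := by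
    rw [← ha, ofReal_measureReal haf]
  have hb1 : volume (B ∩ Ici b) = ENNReal.ofReal t := by
    rw [← hb, ofReal_measureReal hbf]
  have ha2 : volume (A \ Iic a) = ENNReal.ofReal (volume.real A - t) := by
    rw [← ha, ← ofReal_measureReal (measure_ne_top_of_subset sdiff_subset hA')]
    congr 1
    have := measureReal_inter_add_sdiff (μ := volume) (s := A) (measurableSet_Iic (a := a)) hA'
    linarith
  have hb2 : volume (B \ Ici b) = ENNReal.ofReal (volume.real B - t) := by
    rw [← hb, ← ofReal_measureReal (measure_ne_top_of_subset sdiff_subset hB')]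
    congr 1
    have := measureReal_inter_add_sdiff (μ := volume) (s := B) (measurableSet_Ici (a := b)) hB'
    linarith
  set S : Set (ℝ × ℝ) := {p | p.1 ∈ A ∧ p.2 ∈ B ∧ p.1 + p.2 ∈ C} ∩ {p | p.1 ≤ a ∨ b ≤ p.2}
    with hSdef
  have hS : MeasurableSet S := (measurableSet_rieszSet hA hB hC).inter
    ((measurable_fst measurableSet_Iic).union (measurable_snd measurableSet_Ici))
  have hsub : {p : ℝ × ℝ | p.1 ∈ A ∧ p.2 ∈ B ∧ p.1 + p.2 ∈ C} ⊆
      ((A \ Iic a) ×ˢ (B \ Ici b)) ∪ S := by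
    intro p hp
    by_cases h : p.1 ≤ a ∨ b ≤ p.2
    · exact Or.inr ⟨hp, h⟩
    · push Not at h
      exact Or.inl ⟨⟨hp.1, not_le.2 h.1⟩, ⟨hp.2.1, not_le.2 h.2⟩⟩
  have hS1 : ((volume : Measure ℝ).prod volume) S ≤ ENNReal.ofReal t * volume C := by
    rw [prod_apply_sub hS]
    calc _ ≤ ∫⁻ z, C.indicator (fun _ => ENNReal.ofReal t) z := by
          refine lintegral_mono fun z => ?_
          by_cases hz : z ∈ C
          · rw [indicator_of_mem hz]
            rcases le_total (z - b) a with hab | hab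
            · rw [← ha1]
              refine measure_mono ?_
              rintro x ⟨⟨h1, -, -⟩, h2⟩
              refine ⟨h1, ?_⟩
              simp only [mem_ofPred_eq] at h2
              rcases h2 with h2 | h2
              · exact h2
              · simp only [mem_Iic]; linarith
            · rw [← hb1, ← Measure.measurePreserving_sub_left volume z |>.measure_preimage
                (hB.inter measurableSet_Ici).nullMeasurableSet]
              refine measure_mono ?_
              rintro x ⟨⟨-, h1, -⟩, h2⟩
              refine ⟨h1, ?_⟩
              simp only [mem_ofPred_eq] at h2
              rcases h2 with h2 | h2
              · simp only [mem_Ici]; linarith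
              · exact h2
          · simp only [hz, not_false_eq_true, indicator_of_notMem, nonpos_iff_eq_zero]
            convert measure_empty (μ := (volume : Measure ℝ))
            ext x
            simp only [hSdef, mem_inter_iff, mem_ofPred_eq, add_sub_cancel, hz, and_false,
              false_and, mem_empty_iff_false]
      _ = _ := lintegral_indicator_const hC _
  calc rieszSet A B C ≤ ((volume : Measure ℝ).prod volume) (((A \ Iic a) ×ˢ (B \ Ici b)) ∪ S) :=
        measure_mono hsub
    _ ≤ volume (A \ Iic a) * volume (B \ Ici b) + ENNReal.ofReal t * volume C := by
        refine (measure_union_le _ _).trans (add_le_add (Measure.prod_prod _ _).le hS1)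
    _ = _ := by
        rw [ha2, hb2, ← ofReal_measureReal hC', ← ENNReal.ofReal_mul (by linarith),
          ← ENNReal.ofReal_mul h0.le, ← ENNReal.ofReal_add (by nlinarith) (by positivity)]

theorem volume_triangle_le (α β γ : ℝ) (h : γ ≤ α + β) :
    ((volume : Measure ℝ).prod volume) {p : ℝ × ℝ | p.1 < α ∧ p.2 < β ∧ γ ≤ p.1 + p.2} ≤
      ENNReal.ofReal ((α + β - γ) ^ 2 / 2) := by
  have hm : MeasurableSet {p : ℝ × ℝ | p.1 < α ∧ p.2 < β ∧ γ ≤ p.1 + p.2} :=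
    (measurableSet_lt measurable_fst measurable_const).inter
      ((measurableSet_lt measurable_snd measurable_const).inter
        (measurableSet_le measurable_const (measurable_fst.add measurable_snd)))
  rw [Measure.prod_apply hm]
  calc _ ≤ ∫⁻ x in Ioc (γ - β) α, ENNReal.ofReal (x - (γ - β)) := by
        rw [← lintegral_indicator measurableSet_Ioc]
        refine lintegral_mono fun x => ?_
        by_cases hx : x ∈ Ioc (γ - β) α
        · rw [indicator_of_mem hx]
          refine (measure_mono (t := Ico (γ - x) β) ?_).trans ?_
          · rintro y ⟨-, h2, h3⟩
            simp only at h2 h3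
            exact ⟨by linarith, h2⟩
          · rw [Real.volume_Ico]
            exact ENNReal.ofReal_le_ofReal (by linarith)
        · rw [indicator_of_notMem hx, nonpos_iff_eq_zero]
          convert measure_empty (μ := (volume : Measure ℝ))
          ext y
          simp only [mem_preimage, mem_ofPred_eq, mem_empty_iff_false, iff_false, not_and, not_le]
          intro h1 h2
          by_contra h3
          exact hx ⟨by linarith, h1.le⟩
    _ = ENNReal.ofReal (∫ x in Ioc (γ - β) α, (x - (γ - β))) := by
        refine (ofReal_integral_eq_lintegral_ofReal ?_ ?_).symm
        · exact (continuous_id.sub continuous_const).integrableOn_Ioc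
        · refine (ae_restrict_mem measurableSet_Ioc).mono fun x hx => ?_
          exact sub_nonneg.2 hx.1.le
    _ = _ := by
        rw [← intervalIntegral.integral_of_le (by linarith)]
        congr 1
        rw [intervalIntegral.integral_sub (by simp) (by simp)]
        simp
        ring

theorem volume_triangle_le' (α β γ : ℝ) (h : α + β ≤ γ) :
    ((volume : Measure ℝ).prod volume) {p : ℝ × ℝ | α < p.1 ∧ β < p.2 ∧ p.1 + p.2 ≤ γ} ≤
      ENNReal.ofReal ((γ - α - β) ^ 2 / 2) := by
  rw [← Measure.measure_neg]
  convert volume_triangle_le (-α) (-β) (-γ) (by linarith) using 3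
  · ext p
    simp only [Set.mem_neg, mem_ofPred_eq, Prod.fst_neg, Prod.snd_neg]
    constructor <;> rintro ⟨h1, h2, h3⟩ <;> refine ⟨?_, ?_, ?_⟩ <;> linarith
  · ring

theorem le_rieszSet_ball (p q : ℝ) {a b c t : ℝ} (ha : 0 ≤ a)
    (ht : 2 * t = a + b - c) (h0 : 0 ≤ t) :
    ENNReal.ofReal (a * b) ≤ rieszSet (Metric.ball p (a / 2)) (Metric.ball q (b / 2))
      (Metric.ball (p + q) (c / 2)) + ENNReal.ofReal (t ^ 2) := by
  have hsub : Metric.ball p (a / 2) ×ˢ Metric.ball q (b / 2) ⊆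
      {x : ℝ × ℝ | x.1 ∈ Metric.ball p (a / 2) ∧ x.2 ∈ Metric.ball q (b / 2) ∧
        x.1 + x.2 ∈ Metric.ball (p + q) (c / 2)} ∪
      ({x : ℝ × ℝ | x.1 < p + a / 2 ∧ x.2 < q + b / 2 ∧ p + q + c / 2 ≤ x.1 + x.2} ∪
       {x : ℝ × ℝ | p - a / 2 < x.1 ∧ q - b / 2 < x.2 ∧ x.1 + x.2 ≤ p + q - c / 2}) := by
    rintro ⟨x, y⟩ ⟨h1, h2⟩
    by_cases h3 : x + y ∈ Metric.ball (p + q) (c / 2)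
    · exact Or.inl ⟨h1, h2, h3⟩
    · right
      rw [Real.ball_eq_Ioo] at h1 h2 h3
      simp only [mem_Ioo, not_and_or, not_lt] at h1 h2 h3
      rcases h3 with h3 | h3
      · exact Or.inr ⟨h1.1, h2.1, h3⟩
      · exact Or.inl ⟨h1.2, h2.2, h3⟩
  have hbox : ENNReal.ofReal (a * b) = ((volume : Measure ℝ).prod volume)
      (Metric.ball p (a / 2) ×ˢ Metric.ball q (b / 2)) := by
    rw [Measure.prod_prod, Real.volume_ball, Real.volume_ball, ENNReal.ofReal_mul ha]
    congr 2 <;> ring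
  rw [hbox]
  refine (measure_mono hsub).trans ((measure_union_le _ _).trans (add_le_add le_rfl ?_))
  refine (measure_union_le _ _).trans ((add_le_add (volume_triangle_le _ _ _ (by linarith))
    (volume_triangle_le' _ _ _ (by linarith))).trans ?_)
  rw [← ENNReal.ofReal_add (by positivity) (by positivity)]
  refine ENNReal.ofReal_le_ofReal (le_of_eq ?_)
  have : c = a + b - 2 * t := by linarith
  subst this
  ring

theorem le_rieszSet_ball_of_le (p q : ℝ) {a b c : ℝ} (ha : 0 ≤ a)
    (h : a + c ≤ b) :
    ENNReal.ofReal (a * c) ≤ rieszSet (Metric.ball p (a / 2)) (Metric.ball q (b / 2))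
      (Metric.ball (p + q) (c / 2)) := by
  rw [rieszSet, prod_apply_sub (measurableSet_rieszSet Metric.isOpen_ball.measurableSet
    Metric.isOpen_ball.measurableSet Metric.isOpen_ball.measurableSet)]
  calc ENNReal.ofReal (a * c) = ∫⁻ z, (Metric.ball (p + q) (c / 2)).indicator
        (fun _ => volume (Metric.ball p (a / 2))) z := by
        rw [lintegral_indicator_const Metric.isOpen_ball.measurableSet, Real.volume_ball,
          Real.volume_ball, ENNReal.ofReal_mul ha]
        congr 2 <;> ring
    _ ≤ _ := by
        refine lintegral_mono fun z => ?_
        by_cases hz : z ∈ Metric.ball (p + q) (c / 2)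
        · rw [indicator_of_mem hz]
          refine measure_mono fun x hx => ⟨hx, ?_, by simpa using hz⟩
          rw [Real.ball_eq_Ioo, mem_Ioo] at hz hx ⊢
          constructor <;> linarith [hz.1, hz.2, hx.1, hx.2]
        · simp [hz]

theorem rieszSet_real_le_ball {A B C : Set ℝ} (hA : MeasurableSet A) (hB : MeasurableSet B)
    (hC : MeasurableSet C) (hA' : volume A ≠ ⊤) (hB' : volume B ≠ ⊤) (hC' : volume C ≠ ⊤)
    (p q : ℝ) :
    rieszSet A B C ≤ rieszSet (Metric.ball p (volume.real A / 2))
      (Metric.ball q (volume.real B / 2)) (Metric.ball (p + q) (volume.real C / 2)) := by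
  have hmb : ∀ x r : ℝ, MeasurableSet (Metric.ball x r) := fun _ _ =>
    Metric.isOpen_ball.measurableSet
  have hAB := rieszSet_le_mul (A := A) (B := B) (C := C)
  have hAC := rieszSet_le_mul_left hA hB hC
  have hBC := rieszSet_le_mul_right hA hB hC
  rw [← ofReal_measureReal hA', ← ofReal_measureReal hB',
    ← ENNReal.ofReal_mul measureReal_nonneg] at hAB
  rw [← ofReal_measureReal hA', ← ofReal_measureReal hC',
    ← ENNReal.ofReal_mul measureReal_nonneg] at hAC
  rw [← ofReal_measureReal hB', ← ofReal_measureReal hC',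
    ← ENNReal.ofReal_mul measureReal_nonneg] at hBC
  have hmain := fun t => rieszSet_real_le (t := t) hA hB hC hA' hB' hC'
  have ha : 0 ≤ volume.real A := measureReal_nonneg
  have hb : 0 ≤ volume.real B := measureReal_nonneg
  have hc : 0 ≤ volume.real C := measureReal_nonneg
  generalize volume.real A = a at *
  generalize volume.real B = b at *
  generalize volume.real C = c at *
  rcases le_or_gt (a + c) b with h1 | h1
  · exact hAC.trans (le_rieszSet_ball_of_le p q ha h1)
  rcases le_or_gt (b + c) a with h2 | h2
  · rw [rieszSet_comm (hmb _ _) (hmb _ _) (hmb _ _), add_comm p q]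
    exact hBC.trans (le_rieszSet_ball_of_le q p hb h2)
  rcases le_or_gt (a + b) c with h3 | h3
  · have h := le_rieszSet_ball p q (b := b) (t := 0) (c := a + b) ha (by ring) le_rfl
    simp only [ne_eq, OfNat.ofNat_ne_zero, not_false_eq_true, zero_pow, ENNReal.ofReal_zero,
      add_zero] at h
    exact hAB.trans (h.trans (rieszSet_mono le_rfl le_rfl
      (Metric.ball_subset_ball (by linarith))))
  · set t := (a + b - c) / 2 with ht
    have h := le_rieszSet_ball p q (b := b) (t := t) (c := c) ha (by rw [ht]; ring) (by linarith)
    have h' := hmain t (by linarith) (by linarith) (by linarith)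
    have he : (a - t) * (b - t) + t * c = a * b - t ^ 2 := by
      have : c = a + b - 2 * t := by rw [ht]; ring
      rw [this]; ring
    rw [he, ENNReal.ofReal_sub _ (by positivity)] at h'
    exact h'.trans (tsub_le_iff_right.2 h)

section Steiner

open scoped RealInnerProductSpace

variable {E : Type*} [NormedAddCommGroup E] [InnerProductSpace ℝ E]

/-- The length of the intersection of `A` with the line through `x` in the direction `u`. -/
def lineMeas (u : E) (A : Set E) (x : E) : ℝ≥0∞ :=
  volume {s : ℝ | x + s • u ∈ A}

/-- The Steiner symmetrization of `A` in the direction `u`. -/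
def steiner (u : E) (A : Set E) : Set E :=
  {x | ENNReal.ofReal (2 * |⟪u, x⟫|) < lineMeas u A x}

/-- A slab of unit width orthogonal to `u`. -/
def slab (u : E) : Set E :=
  {x | ⟪u, x⟫ ∈ Ico (0 : ℝ) 1}

variable {u : E} {A B C : Set E}

theorem lineMeas_add_smul (x : E) (s : ℝ) : lineMeas u A (x + s • u) = lineMeas u A x := by
  rw [lineMeas, lineMeas, ← measure_preimage_add volume s {t : ℝ | x + t • u ∈ A}]
  congr 1
  ext t
  simp [add_smul, add_assoc]

theorem exists_slice_ball (hu : ‖u‖ = 1) {r : ℝ} (hr : 0 ≤ r) (x : E) :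
    ∃ ρ : ℝ, 0 ≤ ρ ∧ {s : ℝ | x + s • u ∈ Metric.ball (0 : E) r} = Metric.ball (-⟪u, x⟫) ρ := by
  refine ⟨√(r ^ 2 - ‖x‖ ^ 2 + ⟪u, x⟫ ^ 2), Real.sqrt_nonneg _, ?_⟩
  ext s
  rw [mem_ofPred_eq, mem_ball_zero_iff, Metric.mem_ball, Real.dist_eq]
  rw [Real.lt_sqrt (abs_nonneg _), sq_abs, ← sq_lt_sq₀ (norm_nonneg _) hr, norm_add_sq_real,
    inner_smul_right, real_inner_comm, norm_smul, hu, mul_one, Real.norm_eq_abs, sq_abs]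
  constructor <;> intro h <;> nlinarith

theorem slice_steiner (hu : ‖u‖ = 1) {x : E} (hx : lineMeas u A x ≠ ⊤) :
    {s : ℝ | x + s • u ∈ steiner u A} =
      Metric.ball (-⟪u, x⟫) (volume.real {s : ℝ | x + s • u ∈ A} / 2) := by
  ext s
  have hr : lineMeas u A x = ENNReal.ofReal (volume.real {s : ℝ | x + s • u ∈ A}) :=
    (ofReal_measureReal hx).symm
  generalize volume.real {s : ℝ | x + s • u ∈ A} = v at hr
  have hv : 0 ≤ 2 * |⟪u, x⟫ + s| := by positivity
  have hsum : s - -⟪u, x⟫ = ⟪u, x⟫ + s := by ring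
  simp only [steiner, mem_ofPred_eq, lineMeas_add_smul, hr, inner_add_right, inner_smul_right,
    real_inner_self_eq_norm_sq, hu, Metric.mem_ball, Real.dist_eq, one_pow, mul_one, hsum]
  rw [ENNReal.ofReal_lt_ofReal_iff_of_nonneg hv, lt_div_iff₀' two_pos]

theorem lineMeas_steiner (hu : ‖u‖ = 1) {x : E} (hx : lineMeas u A x ≠ ⊤) :
    lineMeas u (steiner u A) x = lineMeas u A x := by
  rw [lineMeas, slice_steiner hu hx, Real.volume_ball, mul_div_cancel₀ _ two_ne_zero]
  exact ofReal_measureReal hx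

theorem lineMeas_ne_top (hu : ‖u‖ = 1) {r : ℝ} (hr : 0 ≤ r) (hA : A ⊆ Metric.ball 0 r) (x : E) :
    lineMeas u A x ≠ ⊤ := by
  obtain ⟨ρ, -, h⟩ := exists_slice_ball hu hr x
  refine measure_ne_top_of_subset (s := {s : ℝ | x + s • u ∈ Metric.ball (0 : E) r})
    (fun s hs => hA hs) ?_
  rw [h, Real.volume_ball]
  exact ENNReal.ofReal_ne_top

theorem steiner_subset_ball (hu : ‖u‖ = 1) {r : ℝ} (hr : 0 ≤ r) (hA : A ⊆ Metric.ball 0 r) :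
    steiner u A ⊆ Metric.ball 0 r := by
  intro x hx
  obtain ⟨ρ, -, h⟩ := exists_slice_ball hu hr x
  have h1 : lineMeas u A x ≤ ENNReal.ofReal (2 * ρ) := by
    rw [← Real.volume_ball (-⟪u, x⟫), ← h]
    exact measure_mono fun s hs => hA hs
  have h2 := (ENNReal.ofReal_lt_ofReal_iff_of_nonneg (by positivity)).1 (lt_of_lt_of_le hx h1)
  have h3 : (0 : ℝ) ∈ {s : ℝ | x + s • u ∈ Metric.ball (0 : E) r} := by
    rw [h, Metric.mem_ball, Real.dist_eq, sub_neg_eq_add, zero_add]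
    linarith
  simpa using h3

theorem lineMeas_inter_translate_le (l : ℝ) (x : E) :
    lineMeas u {z | z ∈ A ∧ z + l • u ∈ B} x ≤ lineMeas u B x := by
  conv_rhs => rw [← lineMeas_add_smul x l]
  refine measure_mono fun s hs => ?_
  have : x + l • u + s • u = x + s • u + l • u := by abel
  simpa only [mem_ofPred_eq, this] using hs.2

variable [FiniteDimensional ℝ E] [MeasurableSpace E] [BorelSpace E]

theorem measurableSet_slab : MeasurableSet (slab u) :=
  (measurable_const.inner measurable_id) measurableSet_Ico

theorem measurable_add_smul : Measurable fun p : E × ℝ => p.1 + p.2 • u :=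
  measurable_fst.add (measurable_snd.smul_const u)

theorem measurableSet_slice (hA : MeasurableSet A) (x : E) :
    MeasurableSet {s : ℝ | x + s • u ∈ A} :=
  (measurable_const.add (measurable_id.smul_const u)) hA

theorem measurable_lineMeas (hA : MeasurableSet A) : Measurable (lineMeas u A) :=
  measurable_measure_prodMk_left (measurable_add_smul (u := u) hA)

theorem measurableSet_steiner (hA : MeasurableSet A) : MeasurableSet (steiner u A) := by
  refine measurableSet_lt ?_ (measurable_lineMeas hA)
  exact ENNReal.measurable_ofReal.comp
    (measurable_const.mul (measurable_const.inner measurable_id).abs)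

theorem lintegral_eq_lintegral_slab (hu : ‖u‖ = 1) {F : E → ℝ≥0∞} (hF : Measurable F) :
    ∫⁻ x, F x = ∫⁻ x in slab u, ∫⁻ s : ℝ, F (x + s • u) := by
  have hind : Measurable ((slab u).indicator (1 : E → ℝ≥0∞)) :=
    measurable_one.indicator measurableSet_slab
  have hm1 : Measurable fun p : E × ℝ => (slab u).indicator (1 : E → ℝ≥0∞) p.1 *
      F (p.1 + p.2 • u) :=
    (hind.comp measurable_fst).mul (hF.comp measurable_add_smul)
  have hm2 : Measurable fun p : ℝ × E => (slab u).indicator (1 : E → ℝ≥0∞) (p.2 - p.1 • u) *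
      F p.2 :=
    (hind.comp (measurable_snd.sub (measurable_fst.smul_const u))).mul (hF.comp measurable_snd)
  calc ∫⁻ x, F x
      = ∫⁻ x, ∫⁻ s : ℝ, (slab u).indicator (1 : E → ℝ≥0∞) (x - s • u) * F x := by
        refine lintegral_congr fun x => ?_
        have hs : ∀ s : ℝ, (slab u).indicator (1 : E → ℝ≥0∞) (x - s • u) =
            (Ioc (⟪u, x⟫ - 1) ⟪u, x⟫).indicator 1 s := by
          intro s
          have : x - s • u ∈ slab u ↔ s ∈ Ioc (⟪u, x⟫ - 1) ⟪u, x⟫ := by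
            simp only [slab, mem_ofPred_eq, inner_sub_right, inner_smul_right,
              real_inner_self_eq_norm_sq, hu, mem_Ico, mem_Ioc]
            constructor <;> rintro ⟨h1, h2⟩ <;> constructor <;> linarith
          by_cases h : s ∈ Ioc (⟪u, x⟫ - 1) ⟪u, x⟫
          · rw [indicator_of_mem h, indicator_of_mem (this.2 h)]; rfl
          · rw [indicator_of_notMem h, indicator_of_notMem (mt this.1 h)]
        simp_rw [hs]
        rw [lintegral_mul_const _ (measurable_one.indicator measurableSet_Ioc),
          lintegral_indicator_one measurableSet_Ioc, Real.volume_Ioc]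
        simp
    _ = ∫⁻ s : ℝ, ∫⁻ x, (slab u).indicator (1 : E → ℝ≥0∞) (x - s • u) * F x :=
        (lintegral_lintegral_swap hm2.aemeasurable).symm
    _ = ∫⁻ s : ℝ, ∫⁻ x, (slab u).indicator (1 : E → ℝ≥0∞) x * F (x + s • u) := by
        refine lintegral_congr fun s => ?_
        rw [← lintegral_add_right_eq_self _ (s • u)]
        simp
    _ = ∫⁻ x, ∫⁻ s : ℝ, (slab u).indicator (1 : E → ℝ≥0∞) x * F (x + s • u) :=
        (lintegral_lintegral_swap hm1.aemeasurable).symm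
    _ = _ := by
        rw [← lintegral_indicator measurableSet_slab]
        refine lintegral_congr fun x => ?_
        by_cases hx : x ∈ slab u <;> simp [hx]

theorem volume_eq_lintegral_slab (hu : ‖u‖ = 1) (hA : MeasurableSet A) :
    volume A = ∫⁻ x in slab u, lineMeas u A x := by
  rw [← lintegral_indicator_one hA,
    lintegral_eq_lintegral_slab hu (measurable_one.indicator hA)]
  refine lintegral_congr fun x => ?_
  rw [lineMeas, ← lintegral_indicator_one (measurableSet_slice hA x)]
  rfl

theorem prod_eq_lintegral_slab (hu : ‖u‖ = 1) {S : Set (E × E)} (hS : MeasurableSet S) :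
    ((volume : Measure E).prod volume) S = ∫⁻ x in slab u, ∫⁻ y in slab u,
      ((volume : Measure ℝ).prod volume) {p : ℝ × ℝ | (x + p.1 • u, y + p.2 • u) ∈ S} := by
  have hm : Measurable (S.indicator (1 : E × E → ℝ≥0∞)) := measurable_one.indicator hS
  calc ((volume : Measure E).prod volume) S
      = ∫⁻ x, ∫⁻ y, S.indicator (1 : E × E → ℝ≥0∞) (x, y) := by
        rw [← lintegral_indicator_one hS, lintegral_prod _ hm.aemeasurable]
    _ = ∫⁻ x in slab u, ∫⁻ s : ℝ, ∫⁻ y in slab u, ∫⁻ t : ℝ,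
          S.indicator (1 : E × E → ℝ≥0∞) (x + s • u, y + t • u) := by
        rw [lintegral_eq_lintegral_slab hu hm.lintegral_prod_right']
        refine lintegral_congr fun x => lintegral_congr fun s => ?_
        exact lintegral_eq_lintegral_slab hu (hm.comp measurable_prodMk_left)
    _ = ∫⁻ x in slab u, ∫⁻ y in slab u, ∫⁻ s : ℝ, ∫⁻ t : ℝ,
          S.indicator (1 : E × E → ℝ≥0∞) (x + s • u, y + t • u) := by
        refine lintegral_congr fun x => lintegral_lintegral_swap ?_
        refine Measurable.aemeasurable ?_
        have h3 : Measurable fun p : (ℝ × E) × ℝ =>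
            S.indicator (1 : E × E → ℝ≥0∞) (x + p.1.1 • u, p.1.2 + p.2 • u) :=
          hm.comp ((measurable_const.add (measurable_fst.fst.smul_const u)).prodMk
            (measurable_fst.snd.add (measurable_snd.smul_const u)))
        exact h3.lintegral_prod_right'
    _ = _ := by
        refine lintegral_congr fun x => lintegral_congr fun y => ?_
        have h2 : Measurable fun p : ℝ × ℝ => (x + p.1 • u, y + p.2 • u) :=
          (measurable_const.add (measurable_fst.smul_const u)).prodMk
            (measurable_const.add (measurable_snd.smul_const u))
        have hS2 : MeasurableSet {p : ℝ × ℝ | (x + p.1 • u, y + p.2 • u) ∈ S} := h2 hS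
        rw [← lintegral_indicator_one hS2,
          lintegral_prod _ (measurable_one.indicator hS2).aemeasurable]
        rfl

theorem volume_steiner (hu : ‖u‖ = 1) {r : ℝ} (hr : 0 ≤ r) (hA : A ⊆ Metric.ball 0 r)
    (hAm : MeasurableSet A) : volume (steiner u A) = volume A := by
  rw [volume_eq_lintegral_slab hu hAm, volume_eq_lintegral_slab hu (measurableSet_steiner hAm)]
  exact lintegral_congr fun x => lineMeas_steiner hu (lineMeas_ne_top hu hr hA x)

theorem rieszSet_le_steiner (hu : ‖u‖ = 1) {r : ℝ} (hr : 0 ≤ r) (hAm : MeasurableSet A)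
    (hBm : MeasurableSet B) (hCm : MeasurableSet C) (hA : A ⊆ Metric.ball 0 r)
    (hB : B ⊆ Metric.ball 0 r) (hC : C ⊆ Metric.ball 0 r) :
    rieszSet A B C ≤ rieszSet (steiner u A) (steiner u B) (steiner u C) := by
  have hslice : ∀ (A B C : Set E) (x y : E),
      ((volume : Measure ℝ).prod volume) {p : ℝ × ℝ | (x + p.1 • u, y + p.2 • u) ∈
        {p : E × E | p.1 ∈ A ∧ p.2 ∈ B ∧ p.1 + p.2 ∈ C}} =
      rieszSet {s : ℝ | x + s • u ∈ A} {s : ℝ | y + s • u ∈ B} {s : ℝ | x + y + s • u ∈ C} := by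
    intro A B C x y
    have : ∀ s t : ℝ, x + y + (s + t) • u = x + s • u + (y + t • u) := fun s t => by
      rw [add_smul]; abel
    simp only [rieszSet, mem_ofPred_eq, this]
  rw [rieszSet, rieszSet, prod_eq_lintegral_slab hu (measurableSet_rieszSet hAm hBm hCm),
    prod_eq_lintegral_slab hu (measurableSet_rieszSet (measurableSet_steiner hAm)
      (measurableSet_steiner hBm) (measurableSet_steiner hCm))]
  refine lintegral_mono fun x => lintegral_mono fun y => ?_
  have fA := lineMeas_ne_top hu hr hA x
  have fB := lineMeas_ne_top hu hr hB y
  have fC := lineMeas_ne_top hu hr hC (x + y)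
  simp only [hslice]
  rw [slice_steiner hu fA, slice_steiner hu fB, slice_steiner hu fC, inner_add_right, neg_add]
  exact rieszSet_real_le_ball (measurableSet_slice hAm x) (measurableSet_slice hBm y)
    (measurableSet_slice hCm (x + y)) fA fB fC _ _

theorem volume_steiner_diff_add_le (hu : ‖u‖ = 1) {r ρ : ℝ} (hr : 0 ≤ r) (hρ : 0 ≤ ρ)
    (hAm : MeasurableSet A) (hA : A ⊆ Metric.ball 0 r) (l : ℝ) :
    volume (steiner u A \ Metric.ball 0 ρ) +
      volume {x | x ∈ A \ Metric.ball 0 ρ ∧ x + l • u ∈ Metric.ball 0 ρ \ A} ≤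
      volume (A \ Metric.ball 0 ρ) := by
  set D : Set E := Metric.ball 0 ρ with hD
  have hDm : MeasurableSet D := Metric.isOpen_ball.measurableSet
  have hTm : MeasurableSet {x | x ∈ A \ D ∧ x + l • u ∈ D \ A} :=
    (hAm.diff hDm).inter ((measurable_id.add_const _) (hDm.diff hAm))
  rw [volume_eq_lintegral_slab hu ((measurableSet_steiner hAm).diff hDm),
    volume_eq_lintegral_slab hu hTm, volume_eq_lintegral_slab hu (hAm.diff hDm),
    ← lintegral_add_left (measurable_lineMeas ((measurableSet_steiner hAm).diff hDm))]
  refine lintegral_mono fun x => ?_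
  have fA := lineMeas_ne_top hu hr hA x
  have fD := lineMeas_ne_top hu hρ (subset_refl _) x
  obtain ⟨σ, hσ, hs⟩ := exists_slice_ball hu hρ x
  have hSA := slice_steiner hu fA
  have hTle : lineMeas u {x | x ∈ A \ D ∧ x + l • u ∈ D \ A} x ≤ lineMeas u (A \ D) x :=
    measure_mono fun s hs => hs.1
  have hTle' := lineMeas_inter_translate_le (u := u) (A := A \ D) (B := D \ A) l x
  rcases le_or_gt (volume.real {s : ℝ | x + s • u ∈ A} / 2) σ with h | h
  · have : lineMeas u (steiner u A \ D) x = 0 := by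
      rw [lineMeas]
      convert measure_empty (μ := (volume : Measure ℝ))
      ext s
      rw [mem_ofPred_eq, Set.mem_sdiff, mem_empty_iff_false, iff_false, not_and, not_not]
      intro h1
      have h2 : s ∈ {s : ℝ | x + s • u ∈ steiner u A} := h1
      rw [hSA] at h2
      have h3 := Metric.ball_subset_ball h h2
      rw [← hs] at h3
      exact h3
    rw [this, zero_add]
    exact hTle
  · have h1 : lineMeas u (steiner u A \ D) x + lineMeas u D x = lineMeas u A x := by
      rw [← lineMeas_steiner hu fA, lineMeas, lineMeas, lineMeas]
      have hsub : {s : ℝ | x + s • u ∈ D} ⊆ {s : ℝ | x + s • u ∈ steiner u A} := by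
        rw [hSA, hD, hs]
        exact Metric.ball_subset_ball h.le
      rw [add_comm, ← measure_union _
        (measurableSet_slice ((measurableSet_steiner hAm).diff hDm) x)]
      · congr 1
        ext s
        have := @hsub s
        simp only [mem_union, mem_ofPred_eq, Set.mem_sdiff] at this ⊢
        tauto
      · rw [Set.disjoint_left]
        intro s h1 h2
        exact h2.2 h1
    have h2 : lineMeas u (A \ D) x + lineMeas u D x =
        lineMeas u A x + lineMeas u (D \ A) x := by
      have e1 := measure_inter_add_sdiff (μ := (volume : Measure ℝ)) {s : ℝ | x + s • u ∈ A}
        (measurableSet_slice (u := u) hDm x)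
      have e2 := measure_inter_add_sdiff (μ := (volume : Measure ℝ)) {s : ℝ | x + s • u ∈ D}
        (measurableSet_slice (u := u) hAm x)
      have f1 : lineMeas u (A \ D) x =
          volume ({s : ℝ | x + s • u ∈ A} \ {s : ℝ | x + s • u ∈ D}) := rfl
      have f2 : lineMeas u (D \ A) x =
          volume ({s : ℝ | x + s • u ∈ D} \ {s : ℝ | x + s • u ∈ A}) := rfl
      rw [f1, f2, lineMeas, lineMeas, ← e1, ← e2, inter_comm]
      abel
    refine (add_le_add le_rfl hTle').trans ?_
    refine (ENNReal.add_le_add_iff_right fD).1 ?_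
    rw [h2, ← h1]
    exact le_of_eq (by abel)

end Steiner

section BoundedRiesz

variable {E : Type*} [NormedAddCommGroup E] [InnerProductSpace ℝ E] [FiniteDimensional ℝ E]
  [MeasurableSpace E] [BorelSpace E]

theorem lintegral_volume_inter_translate {P Q : Set E} (hP : MeasurableSet P)
    (hQ : MeasurableSet Q) :
    ∫⁻ w : E, volume {x | x ∈ P ∧ x + w ∈ Q} = volume P * volume Q := by
  have hS : MeasurableSet {p : E × E | p.2 ∈ P ∧ p.2 + p.1 ∈ Q} :=
    (measurable_snd hP).inter ((measurable_snd.add measurable_fst) hQ)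
  have h1 := Measure.prod_apply (μ := (volume : Measure E)) (ν := (volume : Measure E)) hS
  have h2 := Measure.prod_apply_symm (μ := (volume : Measure E)) (ν := (volume : Measure E)) hS
  calc _ = ∫⁻ x : E, volume {w | x ∈ P ∧ x + w ∈ Q} := h1.symm.trans h2
    _ = ∫⁻ x : E, P.indicator (fun _ => volume Q) x := by
        refine lintegral_congr fun x => ?_
        by_cases hx : x ∈ P
        · simp only [hx, true_and, indicator_of_mem]
          exact measure_preimage_add volume x Q
        · simp [hx]
    _ = _ := by rw [lintegral_indicator_const hP, mul_comm]

/-- `A` is a measurable subset of the centered ball of radius `r`, with the same volume as the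
centered ball of radius `ρ ≤ r`. -/
structure VolumeEqBall (r ρ : ℝ) (A : Set E) : Prop where
  nonneg : 0 ≤ ρ
  le : ρ ≤ r
  measurable : MeasurableSet A
  subset : A ⊆ Metric.ball 0 r
  volume_eq : volume A = volume (Metric.ball (0 : E) ρ)

theorem VolumeEqBall.steiner {r ρ : ℝ} {A : Set E} (h : VolumeEqBall r ρ A) {u : E}
    (hu : ‖u‖ = 1) : VolumeEqBall r ρ (steiner u A) where
  nonneg := h.nonneg
  le := h.le
  measurable := measurableSet_steiner h.measurable
  subset := steiner_subset_ball hu (h.nonneg.trans h.le) h.subset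
  volume_eq := (volume_steiner hu (h.nonneg.trans h.le) h.subset h.measurable).trans h.volume_eq

theorem VolumeEqBall.volume_diff {r ρ : ℝ} {A : Set E} (h : VolumeEqBall r ρ A) :
    volume (Metric.ball 0 ρ \ A) = volume (A \ Metric.ball 0 ρ) := by
  have e1 := measure_inter_add_sdiff (μ := volume) A
    (Metric.isOpen_ball (x := (0 : E)) (ε := ρ)).measurableSet
  have e2 := measure_inter_add_sdiff (μ := volume) (Metric.ball (0 : E) ρ) h.measurable
  rw [h.volume_eq, ← e2, inter_comm] at e1
  exact ((ENNReal.add_right_inj (measure_ne_top_of_subset inter_subset_left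
    measure_ball_lt_top.ne)).1 e1).symm

theorem VolumeEqBall.volume_translate_eq_zero {r ρ : ℝ} {A : Set E} (h : VolumeEqBall r ρ A)
    {w : E} (hw : w ∉ Metric.ball (0 : E) (2 * r) ∨ w = 0) :
    volume {x | x ∈ A \ Metric.ball 0 ρ ∧ x + w ∈ Metric.ball 0 ρ \ A} = 0 := by
  convert measure_empty (μ := (volume : Measure E))
  ext x
  rw [mem_ofPred_eq, mem_empty_iff_false, iff_false]
  rintro ⟨h1, h2⟩
  rcases hw with hw | rfl
  · refine hw ?_
    have h3 := mem_ball_zero_iff.1 (h.subset h1.1)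
    have h4 := mem_ball_zero_iff.1 h2.1
    rw [mem_ball_zero_iff]
    have h5 := norm_sub_le (x + w) x
    rw [add_sub_cancel_left] at h5
    linarith [h.le]
  · rw [add_zero] at h2
    exact h1.2 h2.1

theorem measurable_volume_translate {P Q : Set E} (hP : MeasurableSet P) (hQ : MeasurableSet Q) :
    Measurable fun w : E => volume {x | x ∈ P ∧ x + w ∈ Q} := by
  have hS : MeasurableSet {p : E × E | p.2 ∈ P ∧ p.2 + p.1 ∈ Q} :=
    (measurable_snd hP).inter ((measurable_snd.add measurable_fst) hQ)
  exact measurable_measure_prodMk_left hS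

theorem exists_steiner_excess_le {r α β γ : ℝ} {A B C : Set E} (hA : VolumeEqBall r α A)
    (hB : VolumeEqBall r β B) (hC : VolumeEqBall r γ C) {ε κ : ℝ≥0∞}
    (hκ : κ * volume (Metric.ball (0 : E) (2 * r)) < (ε / 3) ^ 2)
    (hε : ε ≤ volume (A \ Metric.ball 0 α) + volume (B \ Metric.ball 0 β) +
      volume (C \ Metric.ball 0 γ)) :
    ∃ u : E, ‖u‖ = 1 ∧
      volume (steiner u A \ Metric.ball 0 α) + volume (steiner u B \ Metric.ball 0 β) +
        volume (steiner u C \ Metric.ball 0 γ) + κ ≤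
      volume (A \ Metric.ball 0 α) + volume (B \ Metric.ball 0 β) +
        volume (C \ Metric.ball 0 γ) := by
  have hm : ∀ ρ : ℝ, MeasurableSet (Metric.ball (0 : E) ρ) := fun ρ =>
    Metric.isOpen_ball.measurableSet
  set g : Set E → ℝ → E → ℝ≥0∞ := fun A ρ w =>
    volume {x | x ∈ A \ Metric.ball 0 ρ ∧ x + w ∈ Metric.ball 0 ρ \ A} with hg
  have hgi : ∀ {A : Set E} {ρ : ℝ}, VolumeEqBall r ρ A →
      ∫⁻ w, g A ρ w = volume (A \ Metric.ball 0 ρ) ^ 2 := by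
    intro A ρ h
    rw [hg, lintegral_volume_inter_translate (h.measurable.diff (hm ρ))
      ((hm ρ).diff h.measurable), h.volume_diff, sq]
  have hgm : ∀ {A : Set E} {ρ : ℝ}, VolumeEqBall r ρ A → Measurable (g A ρ) := fun h =>
    measurable_volume_translate (h.measurable.diff (hm _)) ((hm _).diff h.measurable)
  have hint : (ε / 3) ^ 2 ≤ ∫⁻ w, (g A α w + g B β w + g C γ w) := by
    have hAB : Measurable fun w => g A α w + g B β w := (hgm hA).add (hgm hB)
    rw [lintegral_add_left hAB, lintegral_add_left (hgm hA), hgi hA, hgi hB,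
      hgi hC]
    set a := volume (A \ Metric.ball 0 α)
    set b := volume (B \ Metric.ball 0 β)
    set c := volume (C \ Metric.ball 0 γ)
    have h3 : ε / 3 ≤ max a (max b c) := by
      rw [ENNReal.div_le_iff (by norm_num) (by norm_num)]
      refine hε.trans ?_
      have e1 : a ≤ max a (max b c) := le_max_left _ _
      have e2 : b ≤ max a (max b c) := (le_max_left _ _).trans (le_max_right _ _)
      have e3 : c ≤ max a (max b c) := (le_max_right _ _).trans (le_max_right _ _)
      calc a + b + c ≤ max a (max b c) + max a (max b c) + max a (max b c) := by gcongr
        _ = _ := by ring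
    refine (pow_le_pow_left' h3 2).trans ?_
    rcases max_choice a (max b c) with h | h
    · rw [h, add_assoc]; exact le_self_add
    · rw [h]
      rcases max_choice b c with h | h
      · rw [h, add_right_comm]; exact le_add_self
      · rw [h]; exact le_add_self
  obtain ⟨w, hw⟩ : ∃ w, κ < g A α w + g B β w + g C γ w := by
    by_contra! hcon
    refine absurd (hint.trans ?_) (not_le.2 hκ)
    calc _ ≤ ∫⁻ w, (Metric.ball (0 : E) (2 * r)).indicator (fun _ => κ) w := by
          refine lintegral_mono fun w => ?_
          by_cases hw : w ∈ Metric.ball (0 : E) (2 * r)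
          · rw [indicator_of_mem hw]; exact hcon w
          · simp only [hg, hA.volume_translate_eq_zero (Or.inl hw),
              hB.volume_translate_eq_zero (Or.inl hw), hC.volume_translate_eq_zero (Or.inl hw),
              add_zero, zero_le]
      _ = _ := lintegral_indicator_const (hm _) _
  have hw0 : w ≠ 0 := by
    intro h
    simp only [hg, hA.volume_translate_eq_zero (Or.inr h),
      hB.volume_translate_eq_zero (Or.inr h), hC.volume_translate_eq_zero (Or.inr h),
      add_zero] at hw
    exact not_lt_bot hw
  have hu : ‖(‖w‖⁻¹ • w)‖ = 1 := by
    rw [norm_smul, norm_inv, norm_norm, inv_mul_cancel₀ (norm_ne_zero_iff.2 hw0)]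
  have hwu : ‖w‖ • (‖w‖⁻¹ • w) = w := smul_inv_smul₀ (norm_ne_zero_iff.2 hw0) w
  refine ⟨‖w‖⁻¹ • w, hu, ?_⟩
  have key : ∀ {A : Set E} {ρ : ℝ}, VolumeEqBall r ρ A →
      volume (_root_.steiner (‖w‖⁻¹ • w) A \ Metric.ball 0 ρ) + g A ρ w ≤
        volume (A \ Metric.ball 0 ρ) := by
    intro A ρ h
    have := volume_steiner_diff_add_le hu (h.nonneg.trans h.le) h.nonneg h.measurable h.subset ‖w‖
    rwa [hwu] at this
  refine le_trans ?_ (add_le_add (add_le_add (key hA) (key hB)) (key hC))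
  refine (add_le_add le_rfl hw.le).trans (le_of_eq (by ring))

theorem exists_rieszSet_le_excess_lt {r α β γ : ℝ} {ε κ : ℝ≥0∞} (hε : ε ≠ 0) (hκ0 : κ ≠ ⊤)
    (hκ : κ * volume (Metric.ball (0 : E) (2 * r)) < (ε / 3) ^ 2) (N : ℕ) :
    ∀ {A B C : Set E}, VolumeEqBall r α A → VolumeEqBall r β B → VolumeEqBall r γ C →
      volume (A \ Metric.ball 0 α) + volume (B \ Metric.ball 0 β) +
        volume (C \ Metric.ball 0 γ) ≤ N * κ →
      ∃ A' B' C' : Set E, VolumeEqBall r α A' ∧ VolumeEqBall r β B' ∧ VolumeEqBall r γ C' ∧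
        rieszSet A B C ≤ rieszSet A' B' C' ∧
        volume (A' \ Metric.ball 0 α) + volume (B' \ Metric.ball 0 β) +
          volume (C' \ Metric.ball 0 γ) < ε := by
  induction N with
  | zero =>
    intro A B C hA hB hC h
    refine ⟨A, B, C, hA, hB, hC, le_rfl, lt_of_le_of_lt h ?_⟩
    simpa using pos_iff_ne_zero.2 hε
  | succ N ih =>
    intro A B C hA hB hC h
    rcases lt_or_ge (volume (A \ Metric.ball 0 α) + volume (B \ Metric.ball 0 β) +
      volume (C \ Metric.ball 0 γ)) ε with h1 | h1
    · exact ⟨A, B, C, hA, hB, hC, le_rfl, h1⟩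
    · obtain ⟨u, hu, h2⟩ := exists_steiner_excess_le hA hB hC hκ h1
      have h3 := h2.trans h
      rw [Nat.cast_succ, add_mul, one_mul, ENNReal.add_le_add_iff_right hκ0] at h3
      obtain ⟨A', B', C', h4, h5, h6, h7, h8⟩ := ih (hA.steiner hu) (hB.steiner hu)
        (hC.steiner hu) h3
      refine ⟨A', B', C', h4, h5, h6, le_trans ?_ h7, h8⟩
      exact rieszSet_le_steiner hu (hA.nonneg.trans hA.le) hA.measurable hB.measurable
        hC.measurable hA.subset hB.subset hC.subset

theorem rieszSet_le_add_excess {A B C A' B' C' : Set E} (hA : MeasurableSet A)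
    (hC : MeasurableSet C) (hC' : MeasurableSet C') {V : ℝ≥0∞} (hAV : volume A ≤ V)
    (hBV : volume B ≤ V) (hB : MeasurableSet B) :
    rieszSet A B C ≤ rieszSet A' B' C' +
      (volume (A \ A') + volume (B \ B') + volume (C \ C')) * V := by
  have hsub : {p : E × E | p.1 ∈ A ∧ p.2 ∈ B ∧ p.1 + p.2 ∈ C} ⊆
      {p : E × E | p.1 ∈ A' ∧ p.2 ∈ B' ∧ p.1 + p.2 ∈ C'} ∪
      ({p : E × E | p.1 ∈ A \ A' ∧ p.2 ∈ B ∧ p.1 + p.2 ∈ C} ∪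
      ({p : E × E | p.1 ∈ A ∧ p.2 ∈ B \ B' ∧ p.1 + p.2 ∈ C} ∪
       {p : E × E | p.1 ∈ A ∧ p.2 ∈ B ∧ p.1 + p.2 ∈ C \ C'})) := by
    rintro p ⟨h1, h2, h3⟩
    by_cases h4 : p.1 ∈ A'
    · by_cases h5 : p.2 ∈ B'
      · by_cases h6 : p.1 + p.2 ∈ C'
        · exact Or.inl ⟨h4, h5, h6⟩
        · exact Or.inr (Or.inr (Or.inr ⟨h1, h2, h3, h6⟩))
      · exact Or.inr (Or.inr (Or.inl ⟨h1, ⟨h2, h5⟩, h3⟩))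
    · exact Or.inr (Or.inl ⟨⟨h1, h4⟩, h2, h3⟩)
  refine (measure_mono hsub).trans ((measure_union_le _ _).trans (add_le_add le_rfl ?_))
  refine (measure_union_le _ _).trans ?_
  rw [add_assoc, add_mul, add_mul]
  refine add_le_add (rieszSet_le_mul.trans (by gcongr)) ?_
  refine (measure_union_le _ _).trans (add_le_add (rieszSet_le_mul.trans ?_)
    ((rieszSet_le_mul_left hA hB (hC.diff hC')).trans ?_))
  · rw [mul_comm]; gcongr
  · rw [mul_comm]; gcongr

theorem VolumeEqBall.rieszSet_le {r α β γ : ℝ} {A B C : Set E} (hA : VolumeEqBall r α A)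
    (hB : VolumeEqBall r β B) (hC : VolumeEqBall r γ C) :
    rieszSet A B C ≤
      rieszSet (Metric.ball (0 : E) α) (Metric.ball (0 : E) β) (Metric.ball (0 : E) γ) := by
  set V := volume (Metric.ball (0 : E) (2 * r)) with hV
  have hVt : V ≠ ⊤ := measure_ball_lt_top.ne
  have hle : ∀ {A : Set E} {ρ : ℝ}, VolumeEqBall r ρ A → volume A ≤ V := fun h =>
    measure_mono (h.subset.trans (Metric.ball_subset_ball (by linarith [h.nonneg.trans h.le])))
  refine ENNReal.le_of_forall_pos_le_add fun η hη _ => ?_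
  obtain ⟨ε, hε0, hε⟩ := ENNReal.exists_nnreal_pos_mul_lt hVt
    (ENNReal.coe_ne_zero.2 hη.ne')
  have hε3 : ((ε : ℝ≥0∞) / 3) ^ 2 ≠ 0 := by
    refine pow_ne_zero 2 (ENNReal.div_ne_zero.2 ⟨ENNReal.coe_ne_zero.2 hε0.ne', by norm_num⟩)
  obtain ⟨κ, hκ0, hκ⟩ := ENNReal.exists_nnreal_pos_mul_lt hVt hε3
  have hft : volume (A \ Metric.ball 0 α) + volume (B \ Metric.ball 0 β) +
      volume (C \ Metric.ball 0 γ) ≠ ⊤ := by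
    refine ENNReal.add_ne_top.2 ⟨ENNReal.add_ne_top.2 ⟨?_, ?_⟩, ?_⟩
    · exact ((measure_mono sdiff_subset).trans_lt ((hle hA).trans_lt hVt.lt_top)).ne
    · exact ((measure_mono sdiff_subset).trans_lt ((hle hB).trans_lt hVt.lt_top)).ne
    · exact ((measure_mono sdiff_subset).trans_lt ((hle hC).trans_lt hVt.lt_top)).ne
  obtain ⟨N, hN⟩ := ENNReal.exists_nat_mul_gt (ENNReal.coe_ne_zero.2 hκ0.ne') hft
  obtain ⟨A', B', C', h4, h5, h6, h7, h8⟩ := exists_rieszSet_le_excess_lt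
    (ENNReal.coe_ne_zero.2 hε0.ne') ENNReal.coe_ne_top hκ N hA hB hC hN.le
  refine h7.trans ((rieszSet_le_add_excess (A' := Metric.ball 0 α) (B' := Metric.ball 0 β)
    (C' := Metric.ball 0 γ) h4.measurable h6.measurable
    Metric.isOpen_ball.measurableSet (hle h4) (hle h5) h5.measurable).trans ?_)
  gcongr
  exact (mul_le_mul_left h8.le _).trans hε.le

end BoundedRiesz

section BallRearrange

theorem volume_ball_lt_volume_ball {E : Type*} [NormedAddCommGroup E] [InnerProductSpace ℝ E]
    [FiniteDimensional ℝ E] [MeasurableSpace E] [BorelSpace E] [Nontrivial E] {r s : ℝ}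
    (hr : 0 ≤ r) (h : r < s) :
    volume (Metric.ball (0 : E) r) < volume (Metric.ball (0 : E) s) := by
  rw [Measure.addHaar_ball _ _ hr, Measure.addHaar_ball _ _ (hr.trans h.le)]
  refine ENNReal.mul_lt_mul_left (Metric.measure_ball_pos _ _ one_pos).ne' measure_ball_lt_top.ne ?_
  rw [ENNReal.ofReal_lt_ofReal_iff (pow_pos (hr.trans_lt h) _)]
  exact pow_lt_pow_left₀ h hr Module.finrank_pos.ne'

theorem exists_volume_ball_eq {E : Type*} [NormedAddCommGroup E] [InnerProductSpace ℝ E]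
    [FiniteDimensional ℝ E] [MeasurableSpace E] [BorelSpace E] [Nontrivial E] {v : ℝ≥0∞}
    (hv : v ≠ ⊤) : ∃ ρ : ℝ, 0 ≤ ρ ∧ volume (Metric.ball (0 : E) ρ) = v := by
  have hc0 : volume (Metric.ball (0 : E) 1) ≠ 0 := (Metric.measure_ball_pos _ _ one_pos).ne'
  have hct : volume (Metric.ball (0 : E) 1) ≠ ⊤ := measure_ball_lt_top.ne
  refine ⟨(v / volume (Metric.ball (0 : E) 1)).toReal ^ ((Module.finrank ℝ E : ℝ)⁻¹), by positivity,
    ?_⟩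
  rw [Measure.addHaar_ball _ _ (by positivity), Real.rpow_inv_natCast_pow ENNReal.toReal_nonneg
    Module.finrank_pos.ne', ENNReal.ofReal_toReal (ENNReal.div_ne_top hv hc0),
    ENNReal.div_mul_cancel hc0 hct]

variable {n : ℕ}

theorem ballRearrange_mono {A B : Set (EuclideanSpace ℝ (Fin n))} (h : volume A ≤ volume B) :
    ballRearrange n A ⊆ ballRearrange n B := fun _ hx => lt_of_lt_of_le hx h

theorem exists_ballRearrange_eq_ball {A : Set (EuclideanSpace ℝ (Fin n))} (hA : volume A ≠ ⊤) :
    ∃ ρ : ℝ, 0 ≤ ρ ∧ ballRearrange n A = Metric.ball 0 ρ ∧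
      volume (Metric.ball (0 : EuclideanSpace ℝ (Fin n)) ρ) = volume A := by
  rcases subsingleton_or_nontrivial (EuclideanSpace ℝ (Fin n)) with hn | hn
  · rcases eq_empty_or_nonempty A with rfl | ⟨x, hx⟩
    · refine ⟨0, le_rfl, ?_, by simp⟩
      ext y
      simp [ballRearrange]
    · obtain rfl : A = univ := eq_univ_of_forall fun y => Subsingleton.elim x y ▸ hx
      have h1 : Metric.ball (0 : EuclideanSpace ℝ (Fin n)) 1 = univ :=
        eq_univ_of_forall fun y => by simp [Subsingleton.elim y 0]
      refine ⟨1, zero_le_one, ?_, by rw [h1]⟩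
      rw [h1]
      refine eq_univ_of_forall fun y => ?_
      change volume (Metric.ball 0 ‖y‖) < volume univ
      rw [Subsingleton.elim y 0, norm_zero, Metric.ball_zero, measure_empty]
      exact pos_iff_ne_zero.2 (NeZero.ne _)
  · obtain ⟨ρ, hρ, h⟩ := exists_volume_ball_eq (E := EuclideanSpace ℝ (Fin n)) hA
    refine ⟨ρ, hρ, ?_, h⟩
    ext y
    change volume (Metric.ball 0 ‖y‖) < volume A ↔ _
    rw [mem_ball_zero_iff, ← h]
    refine ⟨fun h1 => ?_, volume_ball_lt_volume_ball (norm_nonneg y)⟩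
    by_contra! h2
    exact absurd h1 (not_lt.2 (measure_mono (Metric.ball_subset_ball h2)))

theorem ballRearrange_eq_univ {A : Set (EuclideanSpace ℝ (Fin n))} (hA : volume A = ⊤) :
    ballRearrange n A = univ :=
  eq_univ_of_forall fun _ => by
    change _ < volume A
    rw [hA]
    exact measure_ball_lt_top

theorem volume_ballRearrange (A : Set (EuclideanSpace ℝ (Fin n))) :
    volume (ballRearrange n A) = volume A := by
  by_cases hA : volume A = ⊤
  · rw [ballRearrange_eq_univ hA, hA, ← top_le_iff, ← hA]
    exact measure_mono (subset_univ _)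
  · obtain ⟨ρ, -, h1, h2⟩ := exists_ballRearrange_eq_ball hA
    rw [h1, h2]

theorem measurableSet_ballRearrange (A : Set (EuclideanSpace ℝ (Fin n))) :
    MeasurableSet (ballRearrange n A) := by
  by_cases hA : volume A = ⊤
  · rw [ballRearrange_eq_univ hA]; exact MeasurableSet.univ
  · obtain ⟨ρ, -, h1, -⟩ := exists_ballRearrange_eq_ball hA
    rw [h1]; exact Metric.isOpen_ball.measurableSet

theorem rieszSet_le_ballRearrange_of_subset_ball {R : ℝ} {A B C : Set (EuclideanSpace ℝ (Fin n))}
    (hA : MeasurableSet A) (hB : MeasurableSet B) (hC : MeasurableSet C)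
    (hAR : A ⊆ Metric.ball 0 R) (hBR : B ⊆ Metric.ball 0 R) (hCR : C ⊆ Metric.ball 0 R) :
    rieszSet A B C ≤ rieszSet (ballRearrange n A) (ballRearrange n B) (ballRearrange n C) := by
  have hfin : ∀ {A : Set (EuclideanSpace ℝ (Fin n))}, A ⊆ Metric.ball 0 R → volume A ≠ ⊤ :=
    fun h => measure_ne_top_of_subset h measure_ball_lt_top.ne
  obtain ⟨α, hα, hA1, hA2⟩ := exists_ballRearrange_eq_ball (hfin hAR)
  obtain ⟨β, hβ, hB1, hB2⟩ := exists_ballRearrange_eq_ball (hfin hBR)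
  obtain ⟨γ, hγ, hC1, hC2⟩ := exists_ballRearrange_eq_ball (hfin hCR)
  rw [hA1, hB1, hC1]
  have hsub : ∀ {A : Set (EuclideanSpace ℝ (Fin n))}, A ⊆ Metric.ball 0 R →
      A ⊆ Metric.ball 0 (max R (max α (max β γ))) := fun h =>
    h.trans (Metric.ball_subset_ball (le_max_left _ _))
  exact VolumeEqBall.rieszSet_le (r := max R (max α (max β γ)))
    ⟨hα, by simp, hA, hsub hAR, hA2.symm⟩ ⟨hβ, by simp, hB, hsub hBR, hB2.symm⟩
    ⟨hγ, by simp, hC, hsub hCR, hC2.symm⟩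

/-- The Riesz rearrangement inequality for sets. -/
theorem rieszSet_le_ballRearrange {A B C : Set (EuclideanSpace ℝ (Fin n))}
    (hA : MeasurableSet A) (hB : MeasurableSet B) (hC : MeasurableSet C) :
    rieszSet A B C ≤ rieszSet (ballRearrange n A) (ballRearrange n B) (ballRearrange n C) := by
  set b : ℕ → Set (EuclideanSpace ℝ (Fin n)) := fun k => Metric.ball 0 k with hb
  have hbm : ∀ k, MeasurableSet (b k) := fun k => Metric.isOpen_ball.measurableSet
  have hmono : Monotone b := fun i j h => Metric.ball_subset_ball (Nat.cast_le.2 h)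
  have hU : {p : EuclideanSpace ℝ (Fin n) × EuclideanSpace ℝ (Fin n) |
      p.1 ∈ A ∧ p.2 ∈ B ∧ p.1 + p.2 ∈ C} = ⋃ k, {p | p.1 ∈ A ∩ b k ∧ p.2 ∈ B ∩ b k ∧
        p.1 + p.2 ∈ C ∩ b k} := by
    ext p
    simp only [mem_iUnion]
    constructor
    · rintro ⟨h1, h2, h3⟩
      obtain ⟨k, hk⟩ := exists_nat_gt (‖p.1‖ + ‖p.2‖)
      refine ⟨k, ⟨h1, ?_⟩, ⟨h2, ?_⟩, ⟨h3, ?_⟩⟩ <;> rw [hb, mem_ball_zero_iff]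
      · linarith [norm_nonneg p.2]
      · linarith [norm_nonneg p.1]
      · exact (norm_add_le _ _).trans_lt hk
    · rintro ⟨k, h1, h2, h3⟩
      exact ⟨h1.1, h2.1, h3.1⟩
  rw [rieszSet, hU, Monotone.measure_iUnion]
  · refine iSup_le fun k => ?_
    refine (rieszSet_le_ballRearrange_of_subset_ball (hA.inter (hbm k)) (hB.inter (hbm k))
      (hC.inter (hbm k)) inter_subset_right inter_subset_right inter_subset_right).trans ?_
    exact rieszSet_mono (ballRearrange_mono (measure_mono inter_subset_left))
      (ballRearrange_mono (measure_mono inter_subset_left))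
      (ballRearrange_mono (measure_mono inter_subset_left))
  · rintro i j h p ⟨h1, h2, h3⟩
    exact ⟨⟨h1.1, hmono h h1.2⟩, ⟨h2.1, hmono h h2.2⟩, ⟨h3.1, hmono h h3.2⟩⟩

end BallRearrange

section LayerCake

theorem lintegral_Ioi_indicator_ofReal_lt (x : ℝ≥0∞) :
    ∫⁻ t in Ioi (0 : ℝ), {t : ℝ | ENNReal.ofReal t < x}.indicator 1 t = x := by
  have hm : MeasurableSet {t : ℝ | ENNReal.ofReal t < x} :=
    measurableSet_lt ENNReal.measurable_ofReal measurable_const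
  rw [lintegral_indicator_one hm, Measure.restrict_apply hm]
  rcases eq_or_ne x ⊤ with rfl | hx
  · have : {t : ℝ | ENNReal.ofReal t < ⊤} ∩ Ioi 0 = Ioi 0 := by
      ext t; simp
    rw [this, Real.volume_Ioi]
  · have : {t : ℝ | ENNReal.ofReal t < x} ∩ Ioi 0 = Ioo 0 x.toReal := by
      ext t
      constructor
      · rintro ⟨h1, h2⟩
        exact ⟨h2, (ENNReal.ofReal_lt_iff_lt_toReal (le_of_lt h2) hx).1 h1⟩
      · rintro ⟨h1, h2⟩
        exact ⟨(ENNReal.ofReal_lt_iff_lt_toReal h1.le hx).2 h2, h1⟩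
    rw [this, Real.volume_Ioo, sub_zero, ENNReal.ofReal_toReal hx]

theorem lintegral_mul_eq_lintegral_Ioi {α : Type*} [MeasurableSpace α] {μ : Measure α} [SFinite μ]
    {f w : α → ℝ≥0∞} (hf : Measurable f) (hw : Measurable w) :
    ∫⁻ x, f x * w x ∂μ =
      ∫⁻ t in Ioi (0 : ℝ), ∫⁻ x in {x | ENNReal.ofReal t < f x}, w x ∂μ := by
  have hS : MeasurableSet {p : α × ℝ | ENNReal.ofReal p.2 < f p.1} :=
    measurableSet_lt (ENNReal.measurable_ofReal.comp measurable_snd) (hf.comp measurable_fst)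
  calc ∫⁻ x, f x * w x ∂μ
      = ∫⁻ x, (∫⁻ t in Ioi (0 : ℝ), {p : α × ℝ | ENNReal.ofReal p.2 < f p.1}.indicator
          (fun p => w p.1) (x, t)) ∂μ := by
        refine lintegral_congr fun x => ?_
        conv_lhs => rw [← lintegral_Ioi_indicator_ofReal_lt (f x)]
        rw [← lintegral_mul_const _ (measurable_one.indicator
          (measurableSet_lt ENNReal.measurable_ofReal measurable_const))]
        refine lintegral_congr fun t => ?_
        by_cases h : ENNReal.ofReal t < f x
        · simp [h]
        · simp [h]
    _ = ∫⁻ t in Ioi (0 : ℝ), (∫⁻ x, {p : α × ℝ | ENNReal.ofReal p.2 < f p.1}.indicator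
          (fun p => w p.1) (x, t) ∂μ) := by
        refine lintegral_lintegral_swap ?_
        exact ((hw.comp measurable_fst).indicator hS).aemeasurable
    _ = _ := by
        refine lintegral_congr fun t => ?_
        rw [← lintegral_indicator (measurableSet_lt measurable_const hf)]
        rfl

end LayerCake

section Radial

/-- `G x` depends on `‖x‖` only, and is nonincreasing in `‖x‖`. -/
def RadiallyAntitone {E : Type*} [Norm E] (G : E → ℝ≥0∞) : Prop :=
  ∀ ⦃x y : E⦄, ‖x‖ ≤ ‖y‖ → G y ≤ G x

variable {E : Type*} [NormedAddCommGroup E]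

theorem RadiallyAntitone.eq_of_norm_eq {G : E → ℝ≥0∞} (hG : RadiallyAntitone G) {x y : E}
    (h : ‖x‖ = ‖y‖) : G x = G y :=
  le_antisymm (hG h.ge) (hG h.le)

theorem RadiallyAntitone.measurable [MeasurableSpace E] [BorelSpace E] {G : E → ℝ≥0∞}
    (hG : RadiallyAntitone G) : Measurable G := by
  have hΦ : Antitone fun r : ℝ => ⨆ x : {x : E // r ≤ ‖x‖}, G x := fun r s h =>
    iSup_le fun x => le_iSup (fun x : {x : E // r ≤ ‖x‖} => G x) ⟨x, h.trans x.2⟩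
  have : G = (fun r : ℝ => ⨆ x : {x : E // r ≤ ‖x‖}, G x) ∘ norm := by
    ext y
    exact le_antisymm (le_iSup (fun x : {x : E // ‖y‖ ≤ ‖x‖} => G x) ⟨y, le_rfl⟩)
      (iSup_le fun x => hG x.2)
  rw [this]
  exact hΦ.measurable.comp measurable_norm

variable [InnerProductSpace ℝ E]

theorem norm_reflect_sq (x v m : E) (hv : v ≠ 0) :
    ‖m + (ℝ ∙ v)ᗮ.reflection (x - m)‖ ^ 2 =
      ‖x‖ ^ 2 - 4 * (inner ℝ v (x - m) / ‖v‖ ^ 2) * inner ℝ m v := by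
  have hv2 : ‖v‖ ^ 2 ≠ 0 := pow_ne_zero 2 (norm_ne_zero_iff.2 hv)
  have e : m + (ℝ ∙ v)ᗮ.reflection (x - m) = x - (2 * (inner ℝ v (x - m) / ‖v‖ ^ 2)) • v := by
    rw [Submodule.reflection_orthogonal_apply, Submodule.reflection_singleton_apply]
    simp only [RCLike.ofReal_real_eq_id, id_eq, two_smul, mul_smul]
    abel
  rw [e, norm_sub_sq_real, inner_smul_right, norm_smul, mul_pow, Real.norm_eq_abs, sq_abs]
  set c := inner ℝ v (x - m) / ‖v‖ ^ 2 with hc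
  have h1 : inner ℝ x v = c * ‖v‖ ^ 2 + inner ℝ m v := by
    rw [hc, div_mul_cancel₀ _ hv2, inner_sub_right, real_inner_comm, real_inner_comm m v]
    ring
  rw [h1]
  ring

variable [FiniteDimensional ℝ E] [MeasurableSpace E] [BorelSpace E]

theorem add_mul_le_add_mul_of_le {a b c d : ℝ≥0∞} (h1 : b ≤ a) (h2 : d ≤ c) :
    a * d + b * c ≤ a * c + b * d := by
  obtain ⟨e, rfl⟩ := exists_add_of_le h1
  obtain ⟨k, rfl⟩ := exists_add_of_le h2
  calc (b + e) * d + b * (d + k) ≤ (b + e) * d + b * (d + k) + e * k := le_self_add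
    _ = _ := by ring

/-- The convolution of two symmetric decreasing functions is symmetric decreasing. -/
theorem RadiallyAntitone.lintegral_mul_sub {P Q : E → ℝ≥0∞} (hP : RadiallyAntitone P)
    (hQ : RadiallyAntitone Q) : RadiallyAntitone fun y => ∫⁻ x, P x * Q (y - x) := by
  intro y y' hyy
  rcases eq_or_ne y y' with rfl | hne
  · exact le_rfl
  set v := y - y' with hvdef
  have hv : v ≠ 0 := sub_ne_zero.2 hne
  set m := (2 : ℝ)⁻¹ • (y + y') with hm
  set ρ := (ℝ ∙ v)ᗮ.reflection with hρ
  set σ : E → E := fun x => m + ρ (x - m) with hσ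
  have hσint : ∀ Φ : E → ℝ≥0∞, Measurable Φ → ∫⁻ x, Φ (σ x) = ∫⁻ x, Φ x := by
    intro Φ hΦ
    rw [← lintegral_add_left_eq_self Φ m,
      ← ρ.measurePreserving.lintegral_comp (f := fun x => Φ (m + x))
        (hΦ.comp (measurable_const_add m))]
    exact lintegral_sub_right_eq_self (fun x => Φ (m + ρ x)) m
  have hmy : inner ℝ m v ≤ 0 := by
    have : inner ℝ m v = 2⁻¹ * (‖y‖ ^ 2 - ‖y'‖ ^ 2) := by
      rw [hm, hvdef, real_inner_smul_left, inner_add_left, inner_sub_right, inner_sub_right,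
        real_inner_self_eq_norm_sq, real_inner_self_eq_norm_sq, real_inner_comm y y']
      ring
    rw [this]
    nlinarith [norm_nonneg y, norm_nonneg y']
  have hρv : ρ v = -v := Submodule.reflection_orthogonalComplement_singleton_eq_neg v
  have hσy : ∀ x, ‖y' - σ x‖ = ‖y - x‖ := by
    intro x
    have h1 : y' - σ x = ρ (y - x) := by
      have h2 : y' - m = ρ (y - m) := by
        have h3 : y - m = (2 : ℝ)⁻¹ • v := by rw [hm, hvdef]; module
        rw [h3, map_smul, hρv, hm, hvdef]; module
      have h4 : y - x = (y - m) - (x - m) := by abel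
      rw [h4, map_sub, ← h2, hσ]
      exact (sub_sub _ _ _).symm
    rw [h1, ρ.norm_map]
  have hσy' : ∀ x, ‖y - σ x‖ = ‖y' - x‖ := by
    intro x
    have h1 : y - σ x = ρ (y' - x) := by
      have h2 : y - m = ρ (y' - m) := by
        have h3 : y' - m = -((2 : ℝ)⁻¹ • v) := by rw [hm, hvdef]; module
        rw [h3, map_neg, map_smul, hρv, hm, hvdef]; module
      have h4 : y' - x = (y' - m) - (x - m) := by abel
      rw [h4, map_sub, ← h2, hσ]
      exact (sub_sub _ _ _).symm
    rw [h1, ρ.norm_map]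
  have hcmp : ∀ x, ‖y' - x‖ ^ 2 - ‖y - x‖ ^ 2 = 2 * inner ℝ v (x - m) := by
    intro x
    rw [norm_sub_sq_real, norm_sub_sq_real, hm, hvdef]
    simp only [inner_sub_left, inner_sub_right, inner_add_right, inner_smul_right,
      real_inner_self_eq_norm_sq, real_inner_comm y y']
    ring
  have hpt : ∀ x, P x * Q (y' - x) + P (σ x) * Q (y' - σ x) ≤
      P x * Q (y - x) + P (σ x) * Q (y - σ x) := by
    intro x
    rw [hQ.eq_of_norm_eq (hσy x), hQ.eq_of_norm_eq (hσy' x)]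
    have hn := norm_reflect_sq x v m hv
    have hv2 : 0 < ‖v‖ ^ 2 := pow_pos (norm_pos_iff.2 hv) 2
    rcases le_total 0 (inner ℝ v (x - m)) with h | h
    · refine add_mul_le_add_mul_of_le (hP ?_) (hQ ?_)
      · refine le_of_sq_le_sq ?_ (norm_nonneg _)
        have := mul_nonpos_of_nonneg_of_nonpos (div_nonneg h hv2.le) hmy
        rw [hσ]
        linarith
      · refine le_of_sq_le_sq ?_ (norm_nonneg _)
        linarith [hcmp x]
    · rw [add_comm, add_comm (P x * Q (y - x))]
      refine add_mul_le_add_mul_of_le (hP ?_) (hQ ?_)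
      · refine le_of_sq_le_sq ?_ (norm_nonneg _)
        have := mul_nonneg_of_nonpos_of_nonpos (div_nonpos_of_nonpos_of_nonneg h hv2.le) hmy
        rw [hσ]
        linarith
      · refine le_of_sq_le_sq ?_ (norm_nonneg _)
        linarith [hcmp x]
  have hmeas : ∀ z : E, Measurable fun x => P x * Q (z - x) := fun z =>
    hP.measurable.mul (hQ.measurable.comp (measurable_const.sub measurable_id))
  have hdouble : ∀ z : E, 2 * ∫⁻ x, P x * Q (z - x) =
      ∫⁻ x, (P x * Q (z - x) + P (σ x) * Q (z - σ x)) := by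
    intro z
    rw [lintegral_add_left (hmeas z), hσint _ (hmeas z), two_mul]
  have := lintegral_mono (μ := volume) hpt
  rw [← hdouble, ← hdouble] at this
  exact (ENNReal.mul_le_mul_iff_right two_ne_zero ENNReal.ofNat_ne_top).1 this

theorem RadiallyAntitone.lintegral_mul_add {P Q : E → ℝ≥0∞} (hP : RadiallyAntitone P)
    (hQ : RadiallyAntitone Q) : RadiallyAntitone fun y => ∫⁻ x, P x * Q (x + y) := by
  convert hP.lintegral_mul_sub hQ using 2 with y
  rw [← lintegral_neg_eq_self]
  refine lintegral_congr fun x => ?_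
  rw [hP.eq_of_norm_eq (norm_neg x), neg_add_eq_sub]

end Radial

section SymmRearr

variable {n : ℕ}

theorem measurableSet_prod_ballRearrange (f : EuclideanSpace ℝ (Fin n) → ℝ≥0∞) :
    MeasurableSet {p : EuclideanSpace ℝ (Fin n) × ℝ |
      p.1 ∈ ballRearrange n {x | ENNReal.ofReal p.2 < f x}} := by
  have h1 : Monotone fun r : ℝ => volume (Metric.ball (0 : EuclideanSpace ℝ (Fin n)) r) :=
    fun r s h => measure_mono (Metric.ball_subset_ball h)
  have h2 : Antitone fun t : ℝ => volume {x | ENNReal.ofReal t < f x} :=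
    fun s t h => measure_mono fun x hx => lt_of_le_of_lt (ENNReal.ofReal_le_ofReal h) hx
  exact measurableSet_lt (h1.measurable.comp (measurable_norm.comp measurable_fst))
    (h2.measurable.comp measurable_snd)

theorem radiallyAntitone_indicator {B : Set (EuclideanSpace ℝ (Fin n))}
    (hB : ∀ ⦃x y⦄, ‖x‖ ≤ ‖y‖ → y ∈ B → x ∈ B) :
    RadiallyAntitone (B.indicator (1 : EuclideanSpace ℝ (Fin n) → ℝ≥0∞)) := by
  intro x y h
  by_cases hy : y ∈ B
  · simp [hy, hB h hy]
  · simp [hy]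

theorem ballRearrange_norm_le {A : Set (EuclideanSpace ℝ (Fin n))}
    ⦃x y : EuclideanSpace ℝ (Fin n)⦄ (h : ‖x‖ ≤ ‖y‖) (hy : y ∈ ballRearrange n A) :
    x ∈ ballRearrange n A :=
  lt_of_le_of_lt (measure_mono (Metric.ball_subset_ball h)) hy

theorem radiallyAntitone_symmRearr (f : EuclideanSpace ℝ (Fin n) → ℝ≥0∞) :
    RadiallyAntitone (symmRearr n f) := fun _ _ h =>
  lintegral_mono fun _ => radiallyAntitone_indicator ballRearrange_norm_le h

theorem lintegral_symmRearr_mul (f : EuclideanSpace ℝ (Fin n) → ℝ≥0∞)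
    {w : EuclideanSpace ℝ (Fin n) → ℝ≥0∞} (hw : Measurable w) :
    ∫⁻ x, symmRearr n f x * w x =
      ∫⁻ t in Ioi (0 : ℝ), ∫⁻ x in ballRearrange n {x | ENNReal.ofReal t < f x}, w x := by
  have hS := measurableSet_prod_ballRearrange f
  calc ∫⁻ x, symmRearr n f x * w x
      = ∫⁻ x, ∫⁻ t in Ioi (0 : ℝ), {p : EuclideanSpace ℝ (Fin n) × ℝ |
          p.1 ∈ ballRearrange n {x | ENNReal.ofReal p.2 < f x}}.indicator
          (fun p => w p.1) (x, t) := by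
        refine lintegral_congr fun x => ?_
        rw [symmRearr, ← lintegral_mul_const]
        · refine lintegral_congr fun t => ?_
          by_cases h : x ∈ ballRearrange n {x | ENNReal.ofReal t < f x}
          · simp [h]
          · simp [h]
        · have := (measurable_one.indicator hS (β := ℝ≥0∞)).comp
            (measurable_prodMk_left (x := x) (β := ℝ))
          exact this
    _ = ∫⁻ t in Ioi (0 : ℝ), ∫⁻ x, {p : EuclideanSpace ℝ (Fin n) × ℝ |
          p.1 ∈ ballRearrange n {x | ENNReal.ofReal p.2 < f x}}.indicator
          (fun p => w p.1) (x, t) := by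
        refine lintegral_lintegral_swap ?_
        exact ((hw.comp measurable_fst).indicator hS).aemeasurable
    _ = _ := by
        refine lintegral_congr fun t => ?_
        rw [← lintegral_indicator (measurableSet_ballRearrange _)]
        rfl

theorem lintegral_symmRearr {f : EuclideanSpace ℝ (Fin n) → ℝ≥0∞} (hf : Measurable f) :
    ∫⁻ x, symmRearr n f x = ∫⁻ x, f x := by
  have h1 := lintegral_symmRearr_mul f (measurable_const (a := (1 : ℝ≥0∞)))
  have h2 := lintegral_mul_eq_lintegral_Ioi (μ := volume) hf
    (measurable_const (a := (1 : ℝ≥0∞)))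
  simp only [mul_one, setLIntegral_one, volume_ballRearrange] at h1 h2
  rw [h1, h2]

theorem volume_ballRearrange_inter (A B : Set (EuclideanSpace ℝ (Fin n))) :
    volume (ballRearrange n A ∩ ballRearrange n B) = min (volume A) (volume B) := by
  rcases le_total (volume A) (volume B) with h | h
  · rw [inter_eq_left.2 (ballRearrange_mono h), volume_ballRearrange, min_eq_left h]
  · rw [inter_eq_right.2 (ballRearrange_mono h), volume_ballRearrange, min_eq_right h]

theorem setLIntegral_le_setLIntegral_symmRearr {f : EuclideanSpace ℝ (Fin n) → ℝ≥0∞}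
    (hf : Measurable f) {C : Set (EuclideanSpace ℝ (Fin n))} (hC : MeasurableSet C) :
    ∫⁻ x in C, f x ≤ ∫⁻ x in ballRearrange n C, symmRearr n f x := by
  have e : ∀ {C : Set (EuclideanSpace ℝ (Fin n))} (_ : MeasurableSet C)
      (g : EuclideanSpace ℝ (Fin n) → ℝ≥0∞), ∫⁻ x in C, g x = ∫⁻ x, g x * C.indicator 1 x := by
    intro C hC g
    rw [← lintegral_indicator hC]
    refine lintegral_congr fun x => ?_
    by_cases h : x ∈ C <;> simp [h]
  rw [e hC, e (measurableSet_ballRearrange C), lintegral_mul_eq_lintegral_Ioi hf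
    (measurable_one.indicator hC), lintegral_symmRearr_mul f
    (measurable_one.indicator (measurableSet_ballRearrange C))]
  refine lintegral_mono fun t => ?_
  rw [lintegral_indicator_one hC, lintegral_indicator_one (measurableSet_ballRearrange C),
    Measure.restrict_apply hC, Measure.restrict_apply (measurableSet_ballRearrange C),
    volume_ballRearrange_inter]
  exact le_min (measure_mono inter_subset_left) (measure_mono inter_subset_right)

theorem lintegral_ind_add_eq_rieszSet {A B C : Set (EuclideanSpace ℝ (Fin n))}
    (hA : MeasurableSet A) (hB : MeasurableSet B) (hC : MeasurableSet C) :
    ∫⁻ y in B, ∫⁻ x in A, C.indicator (1 : EuclideanSpace ℝ (Fin n) → ℝ≥0∞) (x + y) =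
      rieszSet A B C := by
  have hS := measurableSet_rieszSet hA hB hC
  rw [rieszSet, Measure.prod_apply_symm hS, ← lintegral_indicator hB]
  refine lintegral_congr fun y => ?_
  by_cases hy : y ∈ B
  · have hm : MeasurableSet {x | x + y ∈ C} := measurable_add_const y hC
    rw [indicator_of_mem hy]
    change ∫⁻ x in A, {x | x + y ∈ C}.indicator 1 x = _
    rw [lintegral_indicator_one hm, Measure.restrict_apply hm, inter_comm]
    congr 1
    ext x
    simp [hy]
  · simp [hy]

theorem setLIntegral_lintegral_mul_swap {F : EuclideanSpace ℝ (Fin n) → ℝ≥0∞} (hF : Measurable F)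
    (A : Set (EuclideanSpace ℝ (Fin n))) {C : Set (EuclideanSpace ℝ (Fin n))}
    (hC : MeasurableSet C) :
    ∫⁻ x in A, ∫⁻ y, F y * C.indicator 1 (x + y) =
      ∫⁻ y, F y * ∫⁻ x in A, C.indicator 1 (x + y) := by
  rw [lintegral_lintegral_swap]
  · refine lintegral_congr fun y => lintegral_const_mul _ ?_
    exact (measurable_one.indicator hC).comp (measurable_add_const y)
  · exact ((hF.comp measurable_snd).mul
      ((measurable_one.indicator hC).comp measurable_add)).aemeasurable

theorem measurable_setLIntegral_indicator_add (A : Set (EuclideanSpace ℝ (Fin n)))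
    {C : Set (EuclideanSpace ℝ (Fin n))} (hC : MeasurableSet C) :
    Measurable fun y => ∫⁻ x in A, C.indicator (1 : EuclideanSpace ℝ (Fin n) → ℝ≥0∞) (x + y) :=
  ((measurable_one.indicator hC).comp (measurable_snd.add measurable_fst)).lintegral_prod_right'
    (f := fun p : EuclideanSpace ℝ (Fin n) × EuclideanSpace ℝ (Fin n) =>
      C.indicator (1 : EuclideanSpace ℝ (Fin n) → ℝ≥0∞) (p.2 + p.1))

theorem setLIntegral_lintegral_le {F G : EuclideanSpace ℝ (Fin n) → ℝ≥0∞} (hF : Measurable F)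
    (hG : Measurable G)
    (hFG : ∀ B, MeasurableSet B → (∀ ⦃x y⦄, ‖x‖ ≤ ‖y‖ → y ∈ B → x ∈ B) →
      ∫⁻ s in Ioi (0 : ℝ), min (volume B) (volume {x | ENNReal.ofReal s < F x}) ≤ ∫⁻ x in B, G x)
    {A C : Set (EuclideanSpace ℝ (Fin n))} (hA : MeasurableSet A) (hC : MeasurableSet C) :
    ∫⁻ x in A, ∫⁻ y, F y * C.indicator 1 (x + y) ≤
      ∫⁻ x in ballRearrange n A, ∫⁻ y, G y * (ballRearrange n C).indicator 1 (x + y) := by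
  have hA' := measurableSet_ballRearrange A
  have hC' := measurableSet_ballRearrange C
  rw [setLIntegral_lintegral_mul_swap hF A hC, setLIntegral_lintegral_mul_swap hG _ hC',
    lintegral_mul_eq_lintegral_Ioi hF (measurable_setLIntegral_indicator_add A hC)]
  set v : EuclideanSpace ℝ (Fin n) → ℝ≥0∞ := fun y =>
    ∫⁻ x in ballRearrange n A,
      (ballRearrange n C).indicator (1 : EuclideanSpace ℝ (Fin n) → ℝ≥0∞) (x + y) with hv
  have hvm : Measurable v := measurable_setLIntegral_indicator_add _ hC'
  have hva : RadiallyAntitone v := by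
    have := (radiallyAntitone_indicator (ballRearrange_norm_le (A := A))).lintegral_mul_add
      (radiallyAntitone_indicator (ballRearrange_norm_le (A := C)))
    refine (congrArg RadiallyAntitone (funext fun y => ?_)).mp this
    rw [hv]
    beta_reduce
    rw [← lintegral_indicator hA']
    refine lintegral_congr fun x => ?_
    by_cases h : x ∈ ballRearrange n A <;> simp [h]
  have hFm : ∀ s : ℝ, MeasurableSet {x | ENNReal.ofReal s < F x} := fun s =>
    measurableSet_lt measurable_const hF
  have hvτ : ∀ τ : ℝ, MeasurableSet {x | ENNReal.ofReal τ < v x} := fun s =>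
    measurableSet_lt measurable_const hvm
  have hanti : ∀ g : EuclideanSpace ℝ (Fin n) → ℝ≥0∞,
      Antitone fun t : ℝ => volume {x | ENNReal.ofReal t < g x} := fun g s t h =>
    measure_mono fun x hx => lt_of_le_of_lt (ENNReal.ofReal_le_ofReal h) hx
  calc _ ≤ ∫⁻ s in Ioi (0 : ℝ), ∫⁻ τ in Ioi (0 : ℝ),
        min (volume {x | ENNReal.ofReal τ < v x}) (volume {x | ENNReal.ofReal s < F x}) := by
        refine lintegral_mono fun s => ?_
        have hB' := measurableSet_ballRearrange {x | ENNReal.ofReal s < F x}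
        rw [lintegral_ind_add_eq_rieszSet hA (hFm s) hC]
        refine (rieszSet_le_ballRearrange hA (hFm s) hC).trans ?_
        rw [← lintegral_ind_add_eq_rieszSet hA' hB' hC', ← lintegral_indicator hB']
        calc _ = ∫⁻ y, v y * (ballRearrange n {x | ENNReal.ofReal s < F x}).indicator 1 y := by
              refine lintegral_congr fun y => ?_
              by_cases h : y ∈ ballRearrange n {x | ENNReal.ofReal s < F x} <;> simp [h, hv]
          _ ≤ _ := by
              rw [lintegral_mul_eq_lintegral_Ioi hvm (measurable_one.indicator hB')]
              refine lintegral_mono fun τ => ?_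
              rw [lintegral_indicator_one hB', Measure.restrict_apply hB']
              refine le_min (measure_mono inter_subset_right) ?_
              exact (measure_mono inter_subset_left).trans (volume_ballRearrange _).le
    _ = ∫⁻ τ in Ioi (0 : ℝ), ∫⁻ s in Ioi (0 : ℝ),
        min (volume {x | ENNReal.ofReal τ < v x}) (volume {x | ENNReal.ofReal s < F x}) := by
        refine lintegral_lintegral_swap ?_
        exact (((hanti v).measurable.comp measurable_snd).min
          ((hanti F).measurable.comp measurable_fst)).aemeasurable
    _ ≤ ∫⁻ τ in Ioi (0 : ℝ), ∫⁻ x in {x | ENNReal.ofReal τ < v x}, G x :=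
        lintegral_mono fun τ => hFG _ (hvτ τ) fun x y h hy => lt_of_lt_of_le hy (hva h)
    _ = ∫⁻ y, v y * G y := (lintegral_mul_eq_lintegral_Ioi hvm hG).symm
    _ = _ := lintegral_congr fun y => mul_comm _ _

theorem setLIntegral_conv2 {f F : EuclideanSpace ℝ (Fin n) → ℝ≥0∞} (hf : Measurable f)
    (hF : Measurable F) {C : Set (EuclideanSpace ℝ (Fin n))} (hC : MeasurableSet C) :
    ∫⁻ z in C, conv2 n f F z = ∫⁻ x, f x * ∫⁻ y, F y * C.indicator 1 (x + y) := by
  calc ∫⁻ z in C, conv2 n f F z = ∫⁻ x, ∫⁻ z in C, f x * F (z - x) := by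
        refine lintegral_lintegral_swap ?_
        exact ((hf.comp measurable_snd).mul
          (hF.comp (measurable_fst.sub measurable_snd))).aemeasurable
    _ = _ := by
        refine lintegral_congr fun x => ?_
        have hFx : Measurable fun z => F (z - x) := hF.comp (measurable_id.sub_const x)
        rw [lintegral_const_mul _ hFx, ← lintegral_indicator hC,
          ← lintegral_add_left_eq_self _ x]
        congr 1
        refine lintegral_congr fun y => ?_
        by_cases h : x + y ∈ C <;> simp [h]

theorem setLIntegral_conv2_le {f F G : EuclideanSpace ℝ (Fin n) → ℝ≥0∞} (hf : Measurable f)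
    (hF : Measurable F) (hG : Measurable G)
    (hFG : ∀ B, MeasurableSet B → (∀ ⦃x y⦄, ‖x‖ ≤ ‖y‖ → y ∈ B → x ∈ B) →
      ∫⁻ s in Ioi (0 : ℝ), min (volume B) (volume {x | ENNReal.ofReal s < F x}) ≤ ∫⁻ x in B, G x)
    {C : Set (EuclideanSpace ℝ (Fin n))} (hC : MeasurableSet C) :
    ∫⁻ z in C, conv2 n f F z ≤ ∫⁻ z in ballRearrange n C, conv2 n (symmRearr n f) G z := by
  have hm : ∀ {F : EuclideanSpace ℝ (Fin n) → ℝ≥0∞} {C : Set (EuclideanSpace ℝ (Fin n))},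
      Measurable F → MeasurableSet C →
      Measurable fun x => ∫⁻ y, F y * C.indicator (1 : EuclideanSpace ℝ (Fin n) → ℝ≥0∞) (x + y) :=
    fun {F C} hF hC =>
    ((hF.comp measurable_snd).mul
      ((measurable_one.indicator hC).comp measurable_add)).lintegral_prod_right'
      (f := fun p : EuclideanSpace ℝ (Fin n) × EuclideanSpace ℝ (Fin n) =>
        F p.2 * C.indicator (1 : EuclideanSpace ℝ (Fin n) → ℝ≥0∞) (p.1 + p.2))
  have hC' := measurableSet_ballRearrange C
  rw [setLIntegral_conv2 hf hF hC, setLIntegral_conv2 (radiallyAntitone_symmRearr f).measurable hG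
    hC', lintegral_mul_eq_lintegral_Ioi hf (hm hF hC), lintegral_symmRearr_mul f (hm hG hC')]
  exact lintegral_mono fun t => setLIntegral_lintegral_le hF hG hFG
    (measurableSet_lt measurable_const hf) hC

end SymmRearr

section Truncation

variable {n : ℕ}

/-- `∫ (F - t)₊ ≤ ∫ (G - t)₊` for every `t > 0`. -/
def TruncLE {α : Type*} [MeasureSpace α] (F G : α → ℝ≥0∞) : Prop :=
  ∀ t : ℝ≥0∞, t ≠ 0 → ∫⁻ x, (F x - t) ≤ ∫⁻ x, (G x - t)

theorem truncLE_of_setLIntegral_le {F G : EuclideanSpace ℝ (Fin n) → ℝ≥0∞} (hF : Measurable F)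
    (hFt : ∫⁻ x, F x ≠ ⊤)
    (h : ∀ C, MeasurableSet C → ∫⁻ x in C, F x ≤ ∫⁻ x in ballRearrange n C, G x) :
    TruncLE F G := by
  intro t _
  set C := {x | t < F x} with hC
  have hCm : MeasurableSet C := measurableSet_lt measurable_const hF
  have h1 : (∫⁻ x, (F x - t)) + t * volume C = ∫⁻ x in C, F x := by
    have e1 : ∫⁻ x, (F x - t) = ∫⁻ x in C, (F x - t) := by
      rw [← lintegral_indicator hCm]
      refine lintegral_congr fun x => ?_
      by_cases hx : x ∈ C
      · rw [indicator_of_mem hx]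
      · rw [indicator_of_notMem hx, tsub_eq_zero_of_le (not_lt.1 hx)]
    rw [e1, ← setLIntegral_const, ← lintegral_add_right _ measurable_const]
    exact setLIntegral_congr_fun hCm fun x hx => tsub_add_cancel_of_le (le_of_lt hx)
  have h2 : t * volume C ≠ ⊤ := by
    refine ne_top_of_le_ne_top hFt (le_trans ?_ (setLIntegral_le_lintegral C F))
    rw [← h1]
    exact le_add_self
  refine (ENNReal.add_le_add_iff_right h2).1 ?_
  calc _ = ∫⁻ x in C, F x := h1
    _ ≤ ∫⁻ x in ballRearrange n C, G x := h C hCm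
    _ ≤ ∫⁻ x in ballRearrange n C, ((G x - t) + t) := lintegral_mono fun x => le_tsub_add
    _ = (∫⁻ x in ballRearrange n C, (G x - t)) + t * volume C := by
        rw [lintegral_add_right _ measurable_const, setLIntegral_const, volume_ballRearrange]
    _ ≤ _ := by gcongr; exact Measure.restrict_le_self

theorem lintegral_Ioi_volume_superlevel {α : Type*} [MeasureSpace α]
    [SFinite (volume : Measure α)] {F : α → ℝ≥0∞} (hF : Measurable F) {a : ℝ} (ha : 0 ≤ a) :
    ∫⁻ s in Ioi a, volume {x | ENNReal.ofReal s < F x} = ∫⁻ x, (F x - ENNReal.ofReal a) := by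
  have hanti : Antitone fun t : ℝ => volume {x | ENNReal.ofReal t < F x} := fun s t h =>
    measure_mono fun x hx => lt_of_le_of_lt (ENNReal.ofReal_le_ofReal h) hx
  have h1 := lintegral_mul_eq_lintegral_Ioi (μ := volume) (hF.sub_const (ENNReal.ofReal a))
    (measurable_const (a := (1 : ℝ≥0∞)))
  simp only [mul_one, setLIntegral_one] at h1
  rw [h1, ← (measurePreserving_add_right (volume : Measure ℝ) a).setLIntegral_comp_preimage
    measurableSet_Ioi hanti.measurable]
  have h2 : (fun x => x + a) ⁻¹' Ioi a = Ioi (0 : ℝ) := by ext x; simp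
  rw [h2]
  refine setLIntegral_congr_fun measurableSet_Ioi fun s hs => ?_
  congr 1
  ext x
  simp only [mem_ofPred_eq]
  rw [ENNReal.ofReal_add (le_of_lt hs) ha, lt_tsub_iff_right]

theorem TruncLE.lintegral_min_volume_le {F G : EuclideanSpace ℝ (Fin n) → ℝ≥0∞}
    (h : TruncLE F G) (hF : Measurable F) (hG : RadiallyAntitone G)
    (hFG : ∫⁻ x, F x ≤ ∫⁻ x, G x) (hGt : ∫⁻ x, G x ≠ ⊤) {B : Set (EuclideanSpace ℝ (Fin n))}
    (hBm : MeasurableSet B) (hB : ∀ ⦃x y⦄, ‖x‖ ≤ ‖y‖ → y ∈ B → x ∈ B) :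
    ∫⁻ s in Ioi (0 : ℝ), min (volume B) (volume {x | ENNReal.ofReal s < F x}) ≤
      ∫⁻ x in B, G x := by
  set t := ⨆ x ∈ Bᶜ, G x with ht
  have hout : ∀ x ∉ B, G x ≤ t := fun x hx => le_iSup₂ (f := fun x (_ : x ∈ Bᶜ) => G x) x hx
  have hin : ∀ x ∈ B, t ≤ G x := fun x hx => iSup₂_le fun y hy =>
    hG (le_of_not_ge fun hyx => hy (hB hyx hx))
  have hsplit : ∫⁻ x in B, G x = (∫⁻ x, (G x - t)) + t * volume B := by
    have e1 : ∫⁻ x, (G x - t) = ∫⁻ x in B, (G x - t) := by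
      rw [← lintegral_indicator hBm]
      refine lintegral_congr fun x => ?_
      by_cases hx : x ∈ B
      · rw [indicator_of_mem hx]
      · rw [indicator_of_notMem hx, tsub_eq_zero_of_le (hout x hx)]
    rw [e1, ← setLIntegral_const, ← lintegral_add_right _ measurable_const]
    exact setLIntegral_congr_fun hBm fun x hx => (tsub_add_cancel_of_le (hin x hx)).symm
  rcases eq_or_ne (volume B) 0 with h0 | h0
  · simp [h0]
  have htt : t ≠ ⊤ := by
    intro htop
    refine ne_top_of_le_ne_top hGt (setLIntegral_le_lintegral B G) ?_
    rw [hsplit, htop, ENNReal.top_mul h0, add_top]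
  have hle : ∫⁻ x, (F x - t) ≤ ∫⁻ x, (G x - t) := by
    rcases eq_or_ne t 0 with h1 | h1
    · simpa [h1] using hFG
    · exact h t h1
  rw [hsplit, ← Ioc_union_Ioi_eq_Ioi (ENNReal.toReal_nonneg (a := t))]
  refine (lintegral_union_le _ _ _).trans ?_
  rw [add_comm]
  refine add_le_add (le_trans ?_ hle) ?_
  · have := lintegral_Ioi_volume_superlevel hF (ENNReal.toReal_nonneg (a := t))
    rw [ENNReal.ofReal_toReal htt] at this
    rw [← this]
    exact lintegral_mono fun s => min_le_right _ _
  · calc _ ≤ ∫⁻ s in Ioc 0 t.toReal, volume B := lintegral_mono fun s => min_le_left _ _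
      _ = t * volume B := by
        rw [setLIntegral_const, Real.volume_Ioc, sub_zero, ENNReal.ofReal_toReal htt, mul_comm]

theorem measurable_conv2 {f F : EuclideanSpace ℝ (Fin n) → ℝ≥0∞} (hf : Measurable f)
    (hF : Measurable F) : Measurable (conv2 n f F) :=
  ((hf.comp measurable_snd).mul
    (hF.comp (measurable_fst.sub measurable_snd))).lintegral_prod_right'
    (f := fun p : EuclideanSpace ℝ (Fin n) × EuclideanSpace ℝ (Fin n) => f p.2 * F (p.1 - p.2))

theorem lintegral_conv2 {f F : EuclideanSpace ℝ (Fin n) → ℝ≥0∞} (hf : Measurable f)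
    (hF : Measurable F) : ∫⁻ x, conv2 n f F x = (∫⁻ x, f x) * ∫⁻ x, F x := by
  rw [← setLIntegral_univ, setLIntegral_conv2 hf hF MeasurableSet.univ]
  simp [lintegral_mul_const _ hf]

theorem IsDensity.symmRearr {f : EuclideanSpace ℝ (Fin n) → ℝ≥0∞} (hf : IsDensity n f) :
    IsDensity n (symmRearr n f) :=
  ⟨(radiallyAntitone_symmRearr f).measurable, (lintegral_symmRearr hf.1).trans hf.2⟩

theorem IsDensity.conv2 {f g : EuclideanSpace ℝ (Fin n) → ℝ≥0∞} (hf : IsDensity n f)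
    (hg : IsDensity n g) : IsDensity n (conv2 n f g) :=
  ⟨measurable_conv2 hf.1 hg.1, by rw [lintegral_conv2 hf.1 hg.1, hf.2, hg.2, one_mul]⟩

theorem TruncLE.conv2 {f F G : EuclideanSpace ℝ (Fin n) → ℝ≥0∞} (h : TruncLE F G)
    (hf : IsDensity n f) (hF : IsDensity n F) (hG : IsDensity n G) (hGr : RadiallyAntitone G) :
    TruncLE (conv2 n f F) (conv2 n (symmRearr n f) G) :=
  truncLE_of_setLIntegral_le (hf.conv2 hF).1 ((hf.conv2 hF).2.trans_ne one_ne_top) fun _ hC =>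
    setLIntegral_conv2_le hf.1 hF.1 hG.1 (fun _ hBm hB => h.lintegral_min_volume_le hF.1 hGr
      (hF.2.trans hG.2.symm).le (hG.2.trans_ne one_ne_top) hBm hB) hC

theorem convList_truncLE (l : List (EuclideanSpace ℝ (Fin n) → ℝ≥0∞)) (hl : l ≠ [])
    (hd : ∀ f ∈ l, IsDensity n f) :
    IsDensity n (convList n l) ∧ IsDensity n (convList n (l.map (symmRearr n))) ∧
      RadiallyAntitone (convList n (l.map (symmRearr n))) ∧
      TruncLE (convList n l) (convList n (l.map (symmRearr n))) := by
  induction l with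
  | nil => exact absurd rfl hl
  | cons f l ih =>
    have hf : IsDensity n f := hd f (by simp)
    cases l with
    | nil =>
      exact ⟨hf, hf.symmRearr, radiallyAntitone_symmRearr f,
        truncLE_of_setLIntegral_le hf.1 (hf.2.trans_ne one_ne_top) fun C hC =>
          setLIntegral_le_setLIntegral_symmRearr hf.1 hC⟩
    | cons g rest =>
      obtain ⟨h1, h2, h3, h4⟩ := ih (by simp) fun f' hf' => hd f' (List.mem_cons_of_mem _ hf')
      exact ⟨hf.conv2 h1, hf.symmRearr.conv2 h2,
        (radiallyAntitone_symmRearr f).lintegral_mul_sub h3, h4.conv2 hf h1 h2 h3⟩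

end Truncation

section Entropy

theorem setLIntegral_Ioc_inv {a b : ℝ} (ha : 0 < a) (hab : a ≤ b) :
    ∫⁻ t in Ioc a b, ENNReal.ofReal t⁻¹ = ENNReal.ofReal (Real.log b - Real.log a) := by
  have h0 : (0 : ℝ) ∉ uIcc a b := fun h => by
    rw [uIcc_of_le hab] at h
    exact absurd h.1 (not_le.2 ha)
  have hi : IntervalIntegrable (fun t : ℝ => t⁻¹) volume a b :=
    (intervalIntegrable_inv_iff).2 (Or.inr h0)
  rw [← ofReal_integral_eq_lintegral_ofReal
    ((intervalIntegrable_iff_integrableOn_Ioc_of_le hab).1 hi)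
    ((ae_restrict_iff' measurableSet_Ioc).2 (ae_of_all _ fun t ht => inv_nonneg.2
      (ha.le.trans ht.1.le))), ← intervalIntegral.integral_of_le hab, integral_inv h0,
    Real.log_div (ha.trans_le hab).ne' ha.ne']

theorem setLIntegral_Ioc_min_mul_inv {x : ℝ≥0∞} (hx : x ≠ ⊤) :
    ∫⁻ t in Ioc (0 : ℝ) 1, min x (ENNReal.ofReal t) * ENNReal.ofReal t⁻¹ =
      ENNReal.ofReal (-(x.toReal * Real.log x.toReal)) + min x 1 := by
  have hone : ∀ {t : ℝ}, 0 < t → ENNReal.ofReal t * ENNReal.ofReal t⁻¹ = 1 := fun ht => by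
    rw [← ENNReal.ofReal_mul ht.le, mul_inv_cancel₀ ht.ne', ENNReal.ofReal_one]
  obtain ⟨r, hr, rfl⟩ : ∃ r : ℝ, 0 ≤ r ∧ x = ENNReal.ofReal r :=
    ⟨x.toReal, ENNReal.toReal_nonneg, (ENNReal.ofReal_toReal hx).symm⟩
  rw [ENNReal.toReal_ofReal hr]
  have hsmall : ∀ {b : ℝ}, b ≤ r → ∫⁻ t in Ioc (0 : ℝ) b,
      min (ENNReal.ofReal r) (ENNReal.ofReal t) * ENNReal.ofReal t⁻¹ = ENNReal.ofReal b := by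
    intro b hb
    rw [setLIntegral_congr_fun (g := fun _ => 1) measurableSet_Ioc fun t ht => ?_]
    · rw [setLIntegral_one, Real.volume_Ioc, sub_zero]
    · beta_reduce
      rw [min_eq_right (ENNReal.ofReal_le_ofReal (ht.2.trans hb)), hone ht.1]
  rcases le_or_gt 1 r with h1 | h1
  · rw [hsmall h1, ENNReal.ofReal_one, min_eq_right (ENNReal.one_le_ofReal.2 h1),
      ENNReal.ofReal_of_nonpos, zero_add]
    exact neg_nonpos.2 (mul_nonneg hr (Real.log_nonneg h1))
  · rw [min_eq_left (ENNReal.ofReal_le_one.2 h1.le)]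
    rcases hr.eq_or_lt with rfl | hr0
    · simp
    · rw [← Ioc_union_Ioc_eq_Ioc hr0.le h1.le, lintegral_union measurableSet_Ioc
        (Ioc_disjoint_Ioc_of_le le_rfl), hsmall le_rfl, add_comm]
      congr 1
      rw [setLIntegral_congr_fun (g := fun t => ENNReal.ofReal r * ENNReal.ofReal t⁻¹)
        measurableSet_Ioc fun t ht => ?_]
      · rw [lintegral_const_mul _ measurable_inv.ennreal_ofReal,
          setLIntegral_Ioc_inv hr0 h1.le, ← ENNReal.ofReal_mul hr, Real.log_one]
        congr 1
        ring
      · beta_reduce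
        rw [min_eq_left (ENNReal.ofReal_le_ofReal ht.1.le)]

theorem setLIntegral_Ioi_tsub_mul_inv {x : ℝ≥0∞} (hx : x ≠ ⊤) :
    (∫⁻ t in Ioi (1 : ℝ), (x - ENNReal.ofReal t) * ENNReal.ofReal t⁻¹) + (x - 1) =
      ENNReal.ofReal (x.toReal * Real.log x.toReal) := by
  obtain ⟨r, hr, rfl⟩ : ∃ r : ℝ, 0 ≤ r ∧ x = ENNReal.ofReal r :=
    ⟨x.toReal, ENNReal.toReal_nonneg, (ENNReal.ofReal_toReal hx).symm⟩
  rw [ENNReal.toReal_ofReal hr]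
  have hlarge : ∀ {b : ℝ}, r ≤ b → ∫⁻ t in Ioi b,
      (ENNReal.ofReal r - ENNReal.ofReal t) * ENNReal.ofReal t⁻¹ = 0 := by
    intro b hb
    rw [setLIntegral_congr_fun (g := fun _ => 0) measurableSet_Ioi fun t ht => ?_]
    · simp
    · beta_reduce
      rw [tsub_eq_zero_of_le (ENNReal.ofReal_le_ofReal (hb.trans (le_of_lt ht))), zero_mul]
  rcases le_or_gt r 1 with h1 | h1
  · rw [hlarge h1, tsub_eq_zero_of_le (ENNReal.ofReal_le_one.2 h1), zero_add,
      ENNReal.ofReal_of_nonpos]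
    exact mul_nonpos_of_nonneg_of_nonpos hr (Real.log_nonpos hr h1)
  · rw [← Ioc_union_Ioi_eq_Ioi h1.le, lintegral_union measurableSet_Ioi
      (Ioc_disjoint_Ioi le_rfl), hlarge le_rfl, add_zero]
    have h2 : ∀ t ∈ Ioc 1 r, (ENNReal.ofReal r - ENNReal.ofReal t) * ENNReal.ofReal t⁻¹ + 1 =
        ENNReal.ofReal r * ENNReal.ofReal t⁻¹ := by
      intro t ht
      have ht0 : 0 < t := one_pos.trans ht.1
      rw [← ENNReal.ofReal_sub _ ht0.le, ← ENNReal.ofReal_mul (sub_nonneg.2 ht.2),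
        ← ENNReal.ofReal_mul hr, ← ENNReal.ofReal_one, ← ENNReal.ofReal_add _ zero_le_one]
      · congr 1
        field_simp
        ring
      · exact mul_nonneg (sub_nonneg.2 ht.2) (inv_nonneg.2 ht0.le)
    have h3 : ENNReal.ofReal r - 1 = ∫⁻ t in Ioc 1 r, 1 := by
      rw [setLIntegral_one, Real.volume_Ioc, ENNReal.ofReal_sub _ zero_le_one, ENNReal.ofReal_one]
    rw [h3, ← lintegral_add_right _ measurable_const, setLIntegral_congr_fun measurableSet_Ioc h2,
      lintegral_const_mul _ measurable_inv.ennreal_ofReal,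
      setLIntegral_Ioc_inv one_pos h1.le, ← ENNReal.ofReal_mul hr, Real.log_one, sub_zero]

variable {n : ℕ}

theorem lintegral_min_add_tsub {F : EuclideanSpace ℝ (Fin n) → ℝ≥0∞} (hF : Measurable F)
    (t : ℝ≥0∞) : (∫⁻ x, min (F x) t) + ∫⁻ x, (F x - t) = ∫⁻ x, F x := by
  rw [← lintegral_add_left (hF.min measurable_const)]
  exact lintegral_congr fun x => (add_comm _ _).trans tsub_add_min

theorem entPos_add_lintegral_min {F : EuclideanSpace ℝ (Fin n) → ℝ≥0∞} (hF : IsDensity n F) :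
    entPos n F + ∫⁻ x, min (F x) 1 =
      ∫⁻ t in Ioc (0 : ℝ) 1, (∫⁻ x, min (F x) (ENNReal.ofReal t)) * ENNReal.ofReal t⁻¹ := by
  rw [entPos, ← lintegral_add_right _ (hF.1.min measurable_const)]
  calc _ = ∫⁻ x, ∫⁻ t in Ioc (0 : ℝ) 1, min (F x) (ENNReal.ofReal t) * ENNReal.ofReal t⁻¹ := by
        refine lintegral_congr_ae ?_
        filter_upwards [ae_lt_top hF.1 (hF.2.trans_ne one_ne_top)] with x hx
        exact (setLIntegral_Ioc_min_mul_inv hx.ne).symm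
    _ = ∫⁻ t in Ioc (0 : ℝ) 1, ∫⁻ x, min (F x) (ENNReal.ofReal t) * ENNReal.ofReal t⁻¹ := by
        refine lintegral_lintegral_swap ?_
        exact (((hF.1.comp measurable_fst).min (ENNReal.measurable_ofReal.comp measurable_snd)).mul
          (ENNReal.measurable_ofReal.comp measurable_snd.inv)).aemeasurable
    _ = _ := lintegral_congr fun t => lintegral_mul_const _ (hF.1.min measurable_const)

theorem entNeg_eq {F : EuclideanSpace ℝ (Fin n) → ℝ≥0∞} (hF : IsDensity n F) :
    entNeg n F = (∫⁻ t in Ioi (1 : ℝ), (∫⁻ x, (F x - ENNReal.ofReal t)) * ENNReal.ofReal t⁻¹) +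
      ∫⁻ x, (F x - 1) := by
  have h1 : ∫⁻ t in Ioi (1 : ℝ), (∫⁻ x, (F x - ENNReal.ofReal t)) * ENNReal.ofReal t⁻¹ =
      ∫⁻ x, ∫⁻ t in Ioi (1 : ℝ), (F x - ENNReal.ofReal t) * ENNReal.ofReal t⁻¹ := by
    rw [lintegral_lintegral_swap]
    · exact lintegral_congr fun t => (lintegral_mul_const _ (hF.1.sub measurable_const)).symm
    · exact (((hF.1.comp measurable_fst).sub (ENNReal.measurable_ofReal.comp measurable_snd)).mul
        (ENNReal.measurable_ofReal.comp measurable_snd.inv)).aemeasurable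
  have hF1 : Measurable fun x => F x - 1 := hF.1.sub measurable_const
  rw [entNeg, h1, ← lintegral_add_right _ hF1]
  refine lintegral_congr_ae ?_
  filter_upwards [ae_lt_top hF.1 (hF.2.trans_ne one_ne_top)] with x hx
  exact (setLIntegral_Ioi_tsub_mul_inv hx.ne).symm

theorem TruncLE.lintegral_min_le {F G : EuclideanSpace ℝ (Fin n) → ℝ≥0∞} (h : TruncLE F G)
    (hF : IsDensity n F) (hG : IsDensity n G) {t : ℝ≥0∞} (ht : t ≠ 0) :
    ∫⁻ x, min (G x) t ≤ ∫⁻ x, min (F x) t := by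
  have h1 := lintegral_min_add_tsub hF.1 t
  have h2 := lintegral_min_add_tsub hG.1 t
  have h3 : ∫⁻ x, (F x - t) ≠ ⊤ := by
    refine ne_top_of_le_ne_top one_ne_top ?_
    rw [← hF.2, ← h1]
    exact le_add_self
  rw [hF.2, ← hG.2, ← h2] at h1
  refine (ENNReal.add_le_add_iff_right h3).1 ?_
  rw [h1]
  exact add_le_add le_rfl (h t ht)

theorem TruncLE.entropy_le {F G : EuclideanSpace ℝ (Fin n) → ℝ≥0∞} (h : TruncLE F G)
    (hF : IsDensity n F) (hG : IsDensity n G) : entropy n G ≤ entropy n F := by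
  have hM := entPos_add_lintegral_min hF
  have hM' := entPos_add_lintegral_min hG
  have hN := entNeg_eq hF
  have hN' := entNeg_eq hG
  have ha := (lintegral_min_add_tsub hF.1 1).trans hF.2
  have ha' := (lintegral_min_add_tsub hG.1 1).trans hG.2
  have hMle : ∫⁻ t in Ioc (0 : ℝ) 1, (∫⁻ x, min (G x) (ENNReal.ofReal t)) * ENNReal.ofReal t⁻¹ ≤
      ∫⁻ t in Ioc (0 : ℝ) 1, (∫⁻ x, min (F x) (ENNReal.ofReal t)) * ENNReal.ofReal t⁻¹ := by
    refine setLIntegral_mono' measurableSet_Ioc fun t ht => ?_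
    gcongr ?_ * _
    exact h.lintegral_min_le hF hG (ENNReal.ofReal_pos.2 ht.1).ne'
  have hNle : ∫⁻ t in Ioi (1 : ℝ), (∫⁻ x, (F x - ENNReal.ofReal t)) * ENNReal.ofReal t⁻¹ ≤
      ∫⁻ t in Ioi (1 : ℝ), (∫⁻ x, (G x - ENNReal.ofReal t)) * ENNReal.ofReal t⁻¹ := by
    refine setLIntegral_mono' measurableSet_Ioi fun t ht => ?_
    gcongr ?_ * _
    exact h _ (ENNReal.ofReal_pos.2 (one_pos.trans ht)).ne'
  rw [← hM, ← hM'] at hMle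
  generalize (∫⁻ t in Ioi (1 : ℝ), (∫⁻ x, (F x - ENNReal.ofReal t)) * ENNReal.ofReal t⁻¹) = N
    at hN hNle
  generalize (∫⁻ t in Ioi (1 : ℝ), (∫⁻ x, (G x - ENNReal.ofReal t)) * ENNReal.ofReal t⁻¹) = N'
    at hN' hNle
  rw [entropy, entropy]
  generalize entPos n F = p at *
  generalize entPos n G = p' at *
  generalize entNeg n F = q at *
  generalize entNeg n G = q' at *
  generalize ∫⁻ x, min (F x) 1 = a at *
  generalize ∫⁻ x, min (G x) 1 = a' at *
  generalize ∫⁻ x, (F x - 1) = b at *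
  generalize ∫⁻ x, (G x - 1) = b' at *
  have hfin : ∀ {a b : ℝ≥0∞}, a + b = 1 → a ≠ ⊤ ∧ b ≠ ⊤ := fun h =>
    ENNReal.add_ne_top.1 (h.trans_ne one_ne_top)
  obtain ⟨haf, hbf⟩ := hfin ha
  obtain ⟨haf', hbf'⟩ := hfin ha'
  rcases eq_or_ne q' ⊤ with hq' | hq'
  · rw [hq', EReal.coe_ennreal_top, EReal.sub_top]
    exact bot_le
  have hNf' : N' ≠ ⊤ := (ENNReal.add_ne_top.1 (hN' ▸ hq')).1
  have hNf : N ≠ ⊤ := ne_top_of_le_ne_top hNf' hNle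
  have hq : q ≠ ⊤ := hN ▸ ENNReal.add_ne_top.2 ⟨hNf, hbf⟩
  rcases eq_or_ne p ⊤ with hp | hp
  · lift q to NNReal using hq
    rw [hp, EReal.coe_ennreal_top]
    exact le_top
  have hp' : p' ≠ ⊤ :=
    (ENNReal.add_ne_top.1 (ne_top_of_le_ne_top (ENNReal.add_ne_top.2 ⟨hp, haf⟩) hMle)).1
  lift p to NNReal using hp
  lift p' to NNReal using hp'
  lift q to NNReal using hq
  lift q' to NNReal using hq'
  lift a to NNReal using haf
  lift a' to NNReal using haf'
  lift b to NNReal using hbf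
  lift b' to NNReal using hbf'
  lift N to NNReal using hNf
  lift N' to NNReal using hNf'
  simp only [EReal.coe_nnreal_eq_coe_real]
  rw [← EReal.coe_sub, ← EReal.coe_sub, EReal.coe_le_coe_iff]
  norm_cast at hMle hNle hN hN' ha ha'
  have e1 : (p' : ℝ) - q' ≤ p - q := by
    have r1 : (p' : ℝ) + a' ≤ p + a := by exact_mod_cast hMle
    have r2 : (N : ℝ) ≤ N' := by exact_mod_cast hNle
    have r3 : (q : ℝ) = N + b := by exact_mod_cast hN
    have r4 : (q' : ℝ) = N' + b' := by exact_mod_cast hN'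
    have r5 : (a : ℝ) + b = 1 := by exact_mod_cast ha
    have r6 : (a' : ℝ) + b' = 1 := by exact_mod_cast ha'
    linarith
  exact e1

end Entropy

/-- Main Theorem, Shannon entropy: if the entropies of `f₁ ⋆ ⋯ ⋆ f_k` and of
`f₁* ⋆ ⋯ ⋆ f_k*` are both well defined, then
`h(f₁ ⋆ ⋯ ⋆ f_k) ≥ h(f₁* ⋆ ⋯ ⋆ f_k*)`, i.e.
`h(X₁ + ⋯ + X_k) ≥ h(X₁* + ⋯ + X_k*)`. -/
theorem entropy_convList_symmRearr (n : ℕ)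
    (l : List (EuclideanSpace ℝ (Fin n) → ℝ≥0∞)) (hl : l ≠ [])
    (hd : ∀ f ∈ l, IsDensity n f)
    (h1 : EntDefined n (convList n l))
    (h2 : EntDefined n (convList n (l.map (symmRearr n)))) :
    entropy n (convList n (l.map (symmRearr n))) ≤ entropy n (convList n l) := by
  obtain ⟨hF, hG, -, h⟩ := convList_truncLE l hl hd
  exact h.entropy_le hF hG
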